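/- Let n ≥ 2. There is a computable function d : List (List (Fin n × Bool) × List (Fin n × Bool)) → Bool such that for every finite list L of pairs of words, d L = true if and only if there exists an injective group homomorphism f : FreeGroup (Fin n) →* FreeGroup (Fin n) with f (FreeGroup.mk U) = FreeGroup.mk V for every pair (U, V) in L. In other words, the multiple monomorphism problem in free groups is solvable: for any two tuples (u_1, …, u_r) and (v_1, …, v_r) one can decide whether there is an injective endomorphism f with f(u_j) = v_j for all 1 ≤ j ≤ r. -/

import Mathlib

set_option linter.unusedSectionVars false
set_option linter.unusedVariables false
namespace MMP
open FreeGroup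

section basics
variable {α : Type} [DecidableEq α]

/-- inverse letter -/
def bar (l : α × Bool) : α × Bool := (l.1, !l.2)

@[simp] theorem bar_bar (l : α × Bool) : bar (bar l) = l := by simp [bar]

theorem bar_ne (l : α × Bool) : bar l ≠ l := by
  rcases l with ⟨a, b⟩; cases b <;> simp [bar]

theorem bar_inj {a b : α × Bool} : bar a = bar b ↔ a = b :=
  ⟨fun h => by rw [← bar_bar a, h, bar_bar], fun h => by rw [h]⟩

/-- letter as group element -/
def lt (l : α × Bool) : FreeGroup α := mk [l]

theorem lt_bar (l : α × Bool) : lt (bar l) = (lt l)⁻¹ := by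
  simp [lt, bar, inv_mk, invRev]

theorem lt_true (a : α) : lt (a, true) = of a := rfl

theorem lt_false (a : α) : lt (a, false) = (of a)⁻¹ := by
  rw [← lt_true, ← lt_bar]; rfl

theorem toWord_lt (l : α × Bool) : (lt l).toWord = [l] := rfl

theorem norm_lt (l : α × Bool) : (lt l).norm = 1 := rfl

theorem lt_injective : Function.Injective (lt (α := α)) := by
  intro a b h
  have := congrArg toWord h
  simpa [toWord_lt] using this

theorem lt_mul_eq_one {a b : α × Bool} : lt a * lt b = 1 ↔ a = bar b := by
  rw [mul_eq_one_iff_eq_inv, ← lt_bar]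
  exact lt_injective.eq_iff

theorem toWord_mk_red {L : List (α × Bool)} (h : IsReduced L) : (mk L).toWord = L := by
  rw [toWord_mk, h.reduce_eq]

theorem mk_append (A B : List (α × Bool)) : mk (A ++ B) = mk A * mk B := by
  rw [mul_mk]

theorem mk_cons (a : α × Bool) (B : List (α × Bool)) : mk (a :: B) = lt a * mk B := by
  rw [lt, mul_mk]; rfl

theorem rel_iff {a b : α × Bool} : (a.1 = b.1 → a.2 = b.2) ↔ b ≠ bar a := by
  rcases a with ⟨a, c⟩; rcases b with ⟨b, d⟩
  simp only [bar, ne_eq, Prod.mk.injEq, not_and]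
  constructor
  · intro h h1 h2; have := h h1.symm; subst this; cases c <;> simp at h2
  · intro h h1; have := h h1.symm; cases c <;> cases d <;> simp_all

theorem red_append {A B : List (α × Bool)} : IsReduced (A ++ B) ↔
    IsReduced A ∧ IsReduced B ∧ ∀ x ∈ A.getLast?, ∀ y ∈ B.head?, y ≠ bar x := by
  unfold FreeGroup.IsReduced
  rw [List.isChain_append]
  simp only [rel_iff]

theorem red_cons {a : α × Bool} {B : List (α × Bool)} : IsReduced (a :: B) ↔
    IsReduced B ∧ ∀ y ∈ B.head?, y ≠ bar a := by
  unfold FreeGroup.IsReduced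
  rw [List.isChain_cons]
  simp only [rel_iff]
  tauto

theorem red_left {A B : List (α × Bool)} (h : IsReduced (A ++ B)) : IsReduced A :=
  (red_append.1 h).1
theorem red_right {A B : List (α × Bool)} (h : IsReduced (A ++ B)) : IsReduced B :=
  (red_append.1 h).2.1

theorem red_invRev {A : List (α × Bool)} (h : IsReduced A) : IsReduced (invRev A) := by
  rw [isReduced_iff_reduce_eq, reduce_invRev, h.reduce_eq]

theorem invRev_eq (A : List (α × Bool)) : invRev A = (A.map bar).reverse := rfl

theorem norm_eq (g : FreeGroup α) : g.norm = g.toWord.length := rfl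

theorem mul_lt_cases (g : FreeGroup α) (b : α × Bool) :
    (g.toWord = (g * lt b).toWord ++ [bar b]) ∨ (g * lt b).toWord = g.toWord ++ [b] := by
  by_cases h : ∃ w, g.toWord = w ++ [bar b]
  · left
    obtain ⟨w, hw⟩ := h
    have hr : IsReduced w := red_left (hw ▸ isReduced_toWord)
    have : g * lt b = mk w := by
      rw [← mk_toWord (x := g), hw, mk_append]
      change mk w * lt (bar b) * lt b = _
      rw [lt_bar]; group
    rw [this, toWord_mk_red hr, hw]
  · right
    have : g * lt b = mk (g.toWord ++ [b]) := by
      rw [mk_append, mk_toWord]; rfl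
    rw [this, toWord_mk_red]
    rw [red_append]
    refine ⟨isReduced_toWord, IsReduced.singleton, ?_⟩
    intro x hx y hy hxy
    simp at hy; subst hy; subst hxy
    apply h
    obtain ⟨w, hw⟩ := List.getLast?_eq_some_iff.1 hx
    exact ⟨w, by simpa using hw⟩

/-- longest common prefix -/
theorem exists_lcp (A B : List (α × Bool)) : ∃ q s t, A = q ++ s ∧ B = q ++ t ∧
    ∀ x ∈ s.head?, ∀ y ∈ t.head?, x ≠ y := by
  induction A generalizing B with
  | nil => exact ⟨[], [], B, by simp⟩
  | cons a A ih =>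
    cases B with
    | nil => exact ⟨[], a :: A, [], by simp⟩
    | cons b B =>
      by_cases h : a = b
      · subst h
        obtain ⟨q, s, t, h1, h2, h3⟩ := ih B
        exact ⟨a :: q, s, t, by simp [h1], by simp [h2], h3⟩
      · exact ⟨[], a :: A, b :: B, by simp, by simp, by simpa using h⟩

theorem cancel (g h : FreeGroup α) : ∃ s q t, g.toWord = s ++ invRev q ∧ h.toWord = q ++ t ∧
    (g * h).toWord = s ++ t := by
  obtain ⟨q, s, t, h1, h2, h3⟩ := exists_lcp (g⁻¹).toWord h.toWord
  have hg : g.toWord = invRev s ++ invRev q := by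
    rw [← invRev_append, ← h1, toWord_inv, invRev_invRev]
  refine ⟨invRev s, q, t, hg, h2, ?_⟩
  have : g * h = mk (invRev s ++ t) := by
    rw [← mk_toWord (x := g), ← mk_toWord (x := h), hg, h2, mk_append, mk_append, mk_append,
      ← inv_mk, ← inv_mk]
    group
  rw [this, toWord_mk_red]
  rw [red_append]
  refine ⟨red_left (hg ▸ isReduced_toWord), red_right (h2 ▸ isReduced_toWord), ?_⟩
  intro x hx y hy hxy
  rw [invRev_eq, List.getLast?_reverse, List.head?_map] at hx
  simp only [Option.mem_def, Option.map_eq_some_iff] at hx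
  obtain ⟨z, hz, rfl⟩ := hx
  rw [bar_bar] at hxy
  exact h3 z hz y hy hxy.symm

/-- length of the common prefix -/
def lcp : List (α × Bool) → List (α × Bool) → ℕ
  | a :: A, b :: B => if a = b then lcp A B + 1 else 0
  | _, _ => 0

theorem lcp_comm (A B : List (α × Bool)) : lcp A B = lcp B A := by
  induction A generalizing B with
  | nil => cases B <;> simp [lcp]
  | cons a A ih => cases B with
    | nil => simp [lcp]
    | cons b B => simp only [lcp, ih B, eq_comm]

theorem lcp_ultra (A B C : List (α × Bool)) : min (lcp A B) (lcp B C) ≤ lcp A C := by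
  induction A generalizing B C with
  | nil => simp [lcp]
  | cons a A ih => cases B with
    | nil => simp [lcp]
    | cons b B => cases C with
      | nil => simp [lcp]
      | cons c C =>
        have := ih B C
        simp only [lcp]
        split_ifs <;> first | omega | (exfalso; simp_all)

theorem lcp_append (q s t : List (α × Bool)) (h : ∀ x ∈ s.head?, ∀ y ∈ t.head?, x ≠ y) :
    lcp (q ++ s) (q ++ t) = q.length := by
  induction q with
  | nil => cases s <;> cases t <;> simp_all [lcp]
  | cons a q ih => simp [lcp, ih]

theorem norm_lcp (g h : FreeGroup α) :
    (g * h).norm + 2 * lcp (g⁻¹).toWord h.toWord = g.norm + h.norm := by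
  obtain ⟨q, s, t, h1, h2, h3⟩ := exists_lcp (g⁻¹).toWord h.toWord
  have hg : g.toWord = invRev s ++ invRev q := by
    rw [← invRev_append, ← h1, toWord_inv, invRev_invRev]
  have : g * h = mk (invRev s ++ t) := by
    rw [← mk_toWord (x := g), ← mk_toWord (x := h), hg, h2, mk_append, mk_append, mk_append,
      ← inv_mk, ← inv_mk]
    group
  rw [h1, h2, lcp_append _ _ _ h3, norm_eq, norm_eq, norm_eq, hg, h2, this, toWord_mk_red]
  · simp; omega
  rw [red_append]
  refine ⟨red_left (hg ▸ isReduced_toWord), red_right (h2 ▸ isReduced_toWord), ?_⟩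
  intro x hx y hy hxy
  rw [invRev_eq, List.getLast?_reverse, List.head?_map] at hx
  simp only [Option.mem_def, Option.map_eq_some_iff] at hx
  obtain ⟨z, hz, rfl⟩ := hx
  rw [bar_bar] at hxy
  exact h3 z hz y hy hxy.symm

end basics
end MMP

set_option linter.unusedSectionVars false
set_option linter.unusedVariables false
namespace MMP
open FreeGroup

section cuts
variable {α : Type} [DecidableEq α]

/-- translates of the cut `B` crossed by `u` -/
def E (B : Set (FreeGroup α)) (u : FreeGroup α) : Set (FreeGroup α) :=
  {g | ¬ (g ∈ B ↔ g * u ∈ B)}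

/-- crossing number -/
noncomputable def ell (B : Set (FreeGroup α)) (u : FreeGroup α) : ℕ := (E B u).ncard

/-- almost invariant -/
def AI (B : Set (FreeGroup α)) : Prop := ∀ u, (E B u).Finite

theorem E_mul (B : Set (FreeGroup α)) (u v : FreeGroup α) :
    E B (u * v) ⊆ E B u ∪ (Equiv.mulRight u⁻¹) '' E B v := by
  intro g hg
  by_cases h : g ∈ E B u
  · exact Or.inl h
  · right
    refine ⟨g * u, ?_, by simp⟩
    simp only [E, Set.mem_ofPred_eq, not_not, mul_assoc] at *
    tauto

theorem E_one (B : Set (FreeGroup α)) : E B 1 = ∅ := by ext g; simp [E]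

theorem word_induction {p : FreeGroup α → Prop} (h1 : p 1) (h : ∀ l g, p g → p (lt l * g)) :
    ∀ g, p g := by
  intro g
  rw [← mk_toWord (x := g)]
  generalize g.toWord = w
  induction w with
  | nil => exact h1
  | cons a w ih => rw [mk_cons]; exact h _ _ ih

theorem AI_of_letters {B : Set (FreeGroup α)} (h : ∀ l, (E B (lt l)).Finite) : AI B := by
  intro u
  induction u using word_induction with
  | h1 => rw [E_one]; exact Set.finite_empty
  | h l g ih => exact (((h l).union (ih.image _))).subset (E_mul _ _ _)

theorem ell_mul {B : Set (FreeGroup α)} (hB : AI B) (u v : FreeGroup α) :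
    ell B (u * v) ≤ ell B u + ell B v := by
  unfold ell
  calc _ ≤ (E B u ∪ (Equiv.mulRight u⁻¹) '' E B v).ncard :=
        Set.ncard_le_ncard (E_mul _ _ _) ((hB u).union ((hB v).image _))
    _ ≤ _ := Set.ncard_union_le _ _
    _ = _ := by rw [Set.ncard_image_of_injective _ (Equiv.injective _)]

theorem E_compl (B : Set (FreeGroup α)) (u) : E Bᶜ u = E B u := by
  ext g; simp only [E, Set.mem_ofPred_eq, Set.mem_compl_iff]; tauto

theorem ell_compl (B : Set (FreeGroup α)) (u) : ell Bᶜ u = ell B u := by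
  unfold ell; rw [E_compl]

theorem AI.compl {B : Set (FreeGroup α)} (h : AI B) : AI Bᶜ := fun u => by
  rw [E_compl]; exact h u

theorem AI.union {A B : Set (FreeGroup α)} (h : AI A) (h' : AI B) : AI (A ∪ B) := fun u => by
  refine ((h u).union (h' u)).subset ?_
  intro g
  simp only [E, Set.mem_ofPred_eq, Set.mem_union]; tauto

theorem AI.inter {A B : Set (FreeGroup α)} (h : AI A) (h' : AI B) : AI (A ∩ B) := fun u => by
  refine ((h u).union (h' u)).subset ?_
  intro g
  simp only [E, Set.mem_ofPred_eq, Set.mem_union, Set.mem_inter_iff]; tauto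

/-- left translate -/
def tr (h : FreeGroup α) (B : Set (FreeGroup α)) : Set (FreeGroup α) := {g | h⁻¹ * g ∈ B}

theorem E_tr (h : FreeGroup α) (B) (u) : E (tr h B) u = (Equiv.mulLeft h) '' E B u := by
  ext g
  rw [Equiv.image_eq_preimage_symm]
  simp [E, tr, mul_assoc]

theorem ell_tr (h : FreeGroup α) (B) (u) : ell (tr h B) u = ell B u := by
  unfold ell; rw [E_tr, Set.ncard_image_of_injective _ (Equiv.injective _)]

theorem AI.tr {B : Set (FreeGroup α)} (hB : AI B) (h) : AI (tr h B) := fun u => by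
  rw [E_tr]; exact (hB u).image _

theorem E_pull (f : FreeGroup α ≃* FreeGroup α) (B) (u) :
    E (f ⁻¹' B) u = f.symm.toEquiv '' E B (f u) := by
  ext g
  rw [Equiv.image_eq_preimage_symm]
  simp [E]

theorem ell_pull (f : FreeGroup α ≃* FreeGroup α) (B) (u) : ell (f ⁻¹' B) u = ell B (f u) := by
  unfold ell; rw [E_pull, Set.ncard_image_of_injective _ (Equiv.injective _)]

theorem AI.pull {B : Set (FreeGroup α)} (hB : AI B) (f : FreeGroup α ≃* FreeGroup α) :
    AI (f ⁻¹' B) := fun u => by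
  rw [E_pull]; exact (hB _).image _

theorem submod {A B : Set (FreeGroup α)} (hA : AI A) (hB : AI B) (u) :
    ell (A ∩ B) u + ell (A ∪ B) u ≤ ell A u + ell B u := by
  unfold ell
  rw [← Set.ncard_union_add_ncard_inter _ _ (hA.inter hB u) (hA.union hB u),
    ← Set.ncard_union_add_ncard_inter _ _ (hA u) (hB u)]
  refine add_le_add (Set.ncard_le_ncard ?_ ((hA u).union (hB u)))
    (Set.ncard_le_ncard ?_ ((hA u).subset Set.inter_subset_left))
  · intro g
    simp only [E, Set.mem_ofPred_eq, Set.mem_union, Set.mem_inter_iff]; tauto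
  · intro g
    simp only [E, Set.mem_ofPred_eq, Set.mem_union, Set.mem_inter_iff]; tauto

/-- total crossing number -/
noncomputable def LL (B : Set (FreeGroup α)) (U : List (FreeGroup α)) : ℕ := (U.map (ell B)).sum

theorem LL_submod {A B : Set (FreeGroup α)} (hA : AI A) (hB : AI B) (U) :
    LL (A ∩ B) U + LL (A ∪ B) U ≤ LL A U + LL B U := by
  unfold LL
  induction U with
  | nil => simp
  | cons u U ih => have := submod hA hB u; simp only [List.map_cons, List.sum_cons]; omega

theorem LL_compl (B : Set (FreeGroup α)) (U) : LL Bᶜ U = LL B U := by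
  unfold LL; congr 1; apply List.map_congr_left; intros; apply ell_compl

theorem LL_tr (h) (B : Set (FreeGroup α)) (U) : LL (tr h B) U = LL B U := by
  unfold LL; congr 1; apply List.map_congr_left; intros; apply ell_tr

/-- standard half space -/
def H (a : α × Bool) : Set (FreeGroup α) := {g | g.toWord.head? = some a}

/-- cut at the base vertex -/
def Bc (c : Option (α × Bool) → Bool) : Set (FreeGroup α) := {g | c g.toWord.head? = true}

theorem head_mul_lt (g : FreeGroup α) (b : α × Bool) (h1 : g ≠ 1) (h2 : g ≠ lt (bar b)) :
    (g * lt b).toWord.head? = g.toWord.head? := by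
  rcases mul_lt_cases g b with h | h
  · cases hw : (g * lt b).toWord with
    | nil =>
      rw [hw] at h
      exact absurd (toWord_injective (h.trans (toWord_lt _).symm)) h2
    | cons a w => rw [h, hw]; rfl
  · rw [h]
    cases hw : g.toWord with
    | nil => exact absurd (toWord_eq_nil_iff.1 hw) h1
    | cons a w => rfl

theorem E_Bc (c : Option (α × Bool) → Bool) (b) : E (Bc c) (lt b) ⊆ {1, lt (bar b)} := by
  intro g hg
  by_contra h
  simp only [Set.mem_insert_iff, Set.mem_singleton_iff, not_or] at h
  apply hg
  simp only [Bc, Set.mem_ofPred_eq, head_mul_lt g b h.1 h.2]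

theorem AI_Bc (c : Option (α × Bool) → Bool) : AI (Bc c) :=
  AI_of_letters fun l => (Set.toFinite {1, lt (bar l)}).subset (E_Bc c l)

theorem H_eq (a : α × Bool) : H a = Bc (fun o => decide (o = some a)) := by
  ext g; simp [H, Bc]

theorem AI_H (a : α × Bool) : AI (H a) := H_eq a ▸ AI_Bc _

/-- number of occurrences of a generator -/
def cnt (a : α) (u : FreeGroup α) : ℕ := u.toWord.countP (fun l => l.1 = a)

theorem ell_H_lt (a b : α × Bool) : ell (H a) (lt b) ≤ if b.1 = a.1 then 1 else 0 := by
  have h0 : E (H a) (lt b) ⊆ {1, lt (bar b)} := by rw [H_eq]; exact E_Bc _ _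
  have e1 : (1 : FreeGroup α) ∈ E (H a) (lt b) ↔ b = a := by
    simp [E, H, toWord_lt]
  have e2 : lt (bar b) ∈ E (H a) (lt b) ↔ bar b = a := by
    have : lt (bar b) * lt b = 1 := by rw [lt_bar]; group
    simp [E, H, toWord_lt, this]
  by_cases h1 : b = a
  · have h2 : bar b ≠ a := by rw [h1]; exact bar_ne a
    have : E (H a) (lt b) ⊆ {1} := by
      intro g hg
      rcases h0 hg with h | h
      · exact h
      · rw [Set.mem_singleton_iff] at h; subst h; exact absurd (e2.1 hg) h2
    have := Set.ncard_le_ncard this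
    simpa [ell, h1] using this
  · by_cases h2 : bar b = a
    · have : E (H a) (lt b) ⊆ {lt (bar b)} := by
        intro g hg
        rcases h0 hg with h | h
        · subst h; exact absurd (e1.1 hg) h1
        · exact h
      have := Set.ncard_le_ncard this
      have h3 : b.1 = a.1 := by rw [← h2]; rfl
      rw [if_pos h3]
      simpa [ell] using this
    · have : E (H a) (lt b) = ∅ := by
        rw [Set.eq_empty_iff_forall_notMem]
        intro g hg
        rcases h0 hg with h | h
        · subst h; exact absurd (e1.1 hg) h1
        · rw [Set.mem_singleton_iff] at h; subst h; exact absurd (e2.1 hg) h2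
      simp [ell, this]

theorem ell_H_le (a : α × Bool) (u : FreeGroup α) : ell (H a) u ≤ cnt a.1 u := by
  unfold cnt
  conv_lhs => rw [← mk_toWord (x := u)]
  generalize u.toWord = w
  induction w with
  | nil => change ell (H a) 1 ≤ _; simp [ell, E_one]
  | cons b w ih =>
    rw [mk_cons]
    have h1 := ell_mul (AI_H a) (lt b) (mk w)
    have h2 := ell_H_lt a b
    rw [List.countP_cons]
    simp only [decide_eq_true_eq]
    omega

theorem sum_cnt [Fintype α] (u : FreeGroup α) : ∑ a, cnt a u = u.norm := by
  unfold cnt; rw [norm_eq]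
  generalize u.toWord = w
  induction w with
  | nil => simp
  | cons b w ih => simp [List.countP_cons, Finset.sum_add_distrib, ih]

/-- total size of a tuple -/
def size (U : List (FreeGroup α)) : ℕ := (U.map FreeGroup.norm).sum

/-- total count -/
def DD (a : α) (U : List (FreeGroup α)) : ℕ := (U.map (cnt a)).sum

theorem LL_H_le (a : α × Bool) (U) : LL (H a) U ≤ DD a.1 U :=
  List.sum_le_sum fun u _ => ell_H_le a u

theorem sum_DD [Fintype α] (U : List (FreeGroup α)) : ∑ a, DD a U = size U := by
  unfold DD size
  induction U with
  | nil => simp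
  | cons u U ih => simp [Finset.sum_add_distrib, ih, sum_cnt]

/-- turn count -/
def T (c : Option (α × Bool) → Bool) : Option (α × Bool) → List (α × Bool) → ℕ
  | p, [] => if c p = c none then 0 else 1
  | p, a :: w => (if c p = c (some a) then 0 else 1) + T c (some (bar a)) w

theorem T_le (c : Option (α × Bool) → Bool) (W A : List (α × Bool)) (h : IsReduced (A ++ W)) :
    T c (invRev A).head? W ≤ {g ∈ E (Bc c) (mk (A ++ W)) | A.length ≤ g.norm}.ncard := by
  induction W generalizing A with
  | nil =>
    simp only [T]
    split_ifs with hc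
    · exact Nat.zero_le _
    · rw [Nat.one_le_iff_ne_zero, Ne, Set.ncard_eq_zero ((AI_Bc c _).subset (Set.sep_subset _ _))]
      refine Set.Nonempty.ne_empty ⟨(mk A)⁻¹, ?_, ?_⟩
      · have hr : (mk A)⁻¹.toWord = invRev A := by
          rw [toWord_inv, toWord_mk_red (red_left h)]
        simp only [E, Bc, Set.mem_ofPred_eq, List.append_nil, inv_mul_cancel, toWord_one, hr,
          List.head?_nil]
        intro h'
        apply hc
        exact Bool.eq_iff_iff.2 h'
      · rw [norm_inv_eq, norm_eq, toWord_mk_red (red_left h)]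
  | cons a W ih =>
    have h' : IsReduced ((A ++ [a]) ++ W) := by simpa using h
    have h1 := ih (A ++ [a]) h'
    have hh : (invRev (A ++ [a])).head? = some (bar a) := by
      rw [invRev_append]; rfl
    have hA : A ++ [a] ++ W = A ++ a :: W := by simp
    rw [hh, hA] at h1
    have fin : ({g ∈ E (Bc c) (mk (A ++ a :: W)) | A.length ≤ g.norm}).Finite :=
      (AI_Bc c _).subset (Set.sep_subset _ _)
    have hsub : {g ∈ E (Bc c) (mk (A ++ a :: W)) | (A ++ [a]).length ≤ g.norm} ⊆
        {g ∈ E (Bc c) (mk (A ++ a :: W)) | A.length ≤ g.norm} := by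
      intro g hg; refine ⟨hg.1, ?_⟩; have := hg.2; simp at this; omega
    simp only [T]
    split_ifs with hc
    · rw [zero_add]; exact h1.trans (Set.ncard_le_ncard hsub fin)
    · have hr : (mk A)⁻¹.toWord = invRev A := by
        rw [toWord_inv, toWord_mk_red (red_left h)]
      have hn : ((mk A)⁻¹ : FreeGroup α).norm = A.length := by
        rw [norm_eq, hr, invRev_length]
      have hmem : (mk A)⁻¹ ∈ {g ∈ E (Bc c) (mk (A ++ a :: W)) | A.length ≤ g.norm} := by
        refine ⟨?_, by rw [hn]⟩
        simp only [E, Bc, Set.mem_ofPred_eq, hr]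
        rw [mk_append, inv_mul_cancel_left, toWord_mk_red (red_right h)]
        intro h'
        apply hc
        exact Bool.eq_iff_iff.2 h'
      have hnot : (mk A)⁻¹ ∉ {g ∈ E (Bc c) (mk (A ++ a :: W)) | (A ++ [a]).length ≤ g.norm} := by
        intro hg; have := hg.2; rw [hn] at this; simp at this
      have := Set.ncard_le_ncard (Set.insert_subset hmem hsub) fin
      rw [Set.ncard_insert_of_notMem hnot (fin.subset hsub)] at this
      omega

theorem T_le_ell (c : Option (α × Bool) → Bool) (u : FreeGroup α) :
    T c none u.toWord ≤ ell (Bc c) u := by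
  have := T_le c u.toWord [] isReduced_toWord
  simpa [mk_toWord, ell] using this

end cuts
end MMP

set_option linter.unusedSectionVars false
set_option linter.unusedVariables false
namespace MMP
open FreeGroup hiding map_mul map_inv map_one

section wh
variable {α : Type} [DecidableEq α]

/-- Whitehead-type endomorphism -/
def whHom (x : α × Bool) (p q : α → ℤ) : FreeGroup α →* FreeGroup α :=
  lift (fun i => if i = x.1 then of i else lt x ^ p i * of i * lt x ^ q i)

theorem whHom_x (x : α × Bool) (p q : α → ℤ) : whHom x p q (lt x) = lt x := by
  obtain ⟨x, b⟩ := x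
  cases b
  · rw [lt_false, map_inv, whHom, lift_apply_of, if_pos rfl]
  · rw [lt_true, whHom, lift_apply_of, if_pos rfl]

theorem whHom_comp (x : α × Bool) (p q : α → ℤ) :
    (whHom x p q).comp (whHom x (-p) (-q)) = MonoidHom.id _ := by
  ext i
  by_cases h : i = x.1
  · simp [whHom, h]
  · have : whHom x (-p) (-q) (of i) = lt x ^ (-p i) * of i * lt x ^ (-q i) := by
      simp [whHom, h]
    rw [MonoidHom.comp_apply, this, map_mul, map_mul, map_zpow, map_zpow, whHom_x]
    have : whHom x p q (of i) = lt x ^ (p i) * of i * lt x ^ (q i) := by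
      simp [whHom, h]
    rw [this, MonoidHom.id_apply]; group

/-- Whitehead-type automorphism -/
def whEquiv (x : α × Bool) (p q : α → ℤ) : FreeGroup α ≃* FreeGroup α :=
  MonoidHom.toMulEquiv (whHom x p q) (whHom x (-p) (-q))
    (by have := whHom_comp x (-p) (-q); simpa using this) (whHom_comp x p q)

/-- small automorphisms -/
def Small (σ : FreeGroup α ≃* FreeGroup α) : Prop :=
  ∀ i, (σ (of i)).norm ≤ 3 ∧ (σ.symm (of i)).norm ≤ 3

theorem norm_zpow_lt (x : α × Bool) (k : ℤ) (hk : k = -1 ∨ k = 0 ∨ k = 1) :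
    (lt x ^ k).norm = if k = 0 then 0 else 1 := by
  rcases hk with h | h | h <;> subst h
  · simp [norm_lt]
  · simp
  · simp [norm_lt]

theorem norm_whHom (x : α × Bool) (p q : α → ℤ) (hp : ∀ i, p i = -1 ∨ p i = 0 ∨ p i = 1)
    (hq : ∀ i, q i = -1 ∨ q i = 0 ∨ q i = 1) (i : α) : (whHom x p q (of i)).norm ≤ 3 := by
  rw [whHom, lift_apply_of]
  split_ifs
  · rw [norm_of]; omega
  · have h1 := norm_mul_le (lt x ^ p i * of i) (lt x ^ q i)
    have h2 := norm_mul_le (lt x ^ p i) (of i)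
    rw [norm_zpow_lt _ _ (hp i), norm_of] at h2
    rw [norm_zpow_lt _ _ (hq i)] at h1
    split_ifs at h1 h2 <;> omega

theorem whEquiv_small (x : α × Bool) (p q : α → ℤ) (hp : ∀ i, p i = -1 ∨ p i = 0 ∨ p i = 1)
    (hq : ∀ i, q i = -1 ∨ q i = 0 ∨ q i = 1) : Small (whEquiv x p q) := by
  intro i
  refine ⟨norm_whHom x p q hp hq i, norm_whHom x (-p) (-q) ?_ ?_ i⟩
  · intro i; have := hp i; simp only [Pi.neg_apply]; omega
  · intro i; have := hq i; simp only [Pi.neg_apply]; omega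

/-- exponent -/
def ex (c : Option (α × Bool) → Bool) (o : Option (α × Bool)) : ℤ := if c o then 1 else 0

/-- Whitehead automorphism of a cut -/
def wc (c : Option (α × Bool) → Bool) (x : α × Bool) : FreeGroup α ≃* FreeGroup α :=
  whEquiv x (fun i => ex c (some (i, true)) - ex c none) (fun i => ex c none - ex c (some (i, false)))

theorem wc_apply (c : Option (α × Bool) → Bool) (x : α × Bool) (g) : wc c x g =
    whHom x (fun i => ex c (some (i, true)) - ex c none)
      (fun i => ex c none - ex c (some (i, false))) g := rfl

theorem ex_diff (c : Option (α × Bool) → Bool) (o o') :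
    ex c o - ex c o' = -1 ∨ ex c o - ex c o' = 0 ∨ ex c o - ex c o' = 1 := by
  unfold ex; split_ifs <;> simp

theorem wc_small (c : Option (α × Bool) → Bool) (x : α × Bool) : Small (wc c x) :=
  whEquiv_small _ _ _ (fun _ => ex_diff _ _ _) (fun _ => ex_diff _ _ _)

theorem wc_of (c : Option (α × Bool) → Bool) (x : α × Bool) (i : α) (h : i ≠ x.1) :
    wc c x (of i) = lt x ^ (ex c (some (i, true)) - ex c none) * of i *
      lt x ^ (ex c none - ex c (some (i, false))) := by
  rw [wc_apply, whHom, lift_apply_of, if_neg h]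

theorem wc_lt (c : Option (α × Bool) → Bool) (x : α × Bool) (h1 : c (some x) = true)
    (h2 : c (some (bar x)) = false) (b : α × Bool) :
    wc c x (lt b) = lt x ^ (ex c (some b) - ex c none) * (if b.1 = x.1 then 1 else lt b) *
      lt x ^ (ex c none - ex c (some (bar b))) := by
  have hx : wc c x (lt x) = lt x := by rw [wc_apply, whHom_x]
  split_ifs with h
  · have : b = x ∨ b = bar x := by
      obtain ⟨b, e⟩ := b; obtain ⟨x, e'⟩ := x
      simp only at h; subst h
      simp [bar]; cases e <;> cases e' <;> simp
    rcases this with h | h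
    · subst h
      rw [hx]; simp only [ex, h1, h2]; rw [mul_one, ← zpow_add]; simp
    · subst h
      rw [lt_bar, map_inv, hx]; simp only [ex, h1, h2, bar_bar]; rw [mul_one, ← zpow_add]; cases c none <;> simp
  · obtain ⟨b, e⟩ := b
    cases e
    · rw [lt_false, map_inv, wc_of _ _ _ h]; simp only [bar, Bool.not_false]; group
    · rw [lt_true, wc_of _ _ _ h]; rfl

theorem norm_zpow_ex (c : Option (α × Bool) → Bool) (x : α × Bool) (o o') :
    (lt x ^ (ex c o - ex c o')).norm = if c o' = c o then 0 else 1 := by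
  rw [norm_zpow_lt _ _ (ex_diff _ _ _)]
  unfold ex
  cases c o <;> cases c o' <;> simp

theorem wc_norm_aux (c : Option (α × Bool) → Bool) (x : α × Bool) (h1 : c (some x) = true)
    (h2 : c (some (bar x)) = false) (W : List (α × Bool)) (p) :
    (lt x ^ (ex c none - ex c p) * wc c x (mk W)).norm + W.countP (fun l => l.1 = x.1) ≤
      T c p W + W.length := by
  induction W generalizing p with
  | nil =>
    have : (mk ([] : List (α × Bool))) = 1 := rfl
    rw [this, map_one, mul_one, norm_zpow_ex]; simp [T]
  | cons a W ih =>
    have ih := ih (some (bar a))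
    rw [mk_cons, map_mul, wc_lt c x h1 h2]
    have e : lt x ^ (ex c none - ex c p) * (lt x ^ (ex c (some a) - ex c none) *
        (if a.1 = x.1 then 1 else lt a) * lt x ^ (ex c none - ex c (some (bar a))) * wc c x (mk W)) =
      lt x ^ (ex c (some a) - ex c p) * ((if a.1 = x.1 then 1 else lt a) *
        (lt x ^ (ex c none - ex c (some (bar a))) * wc c x (mk W))) := by
      have : ex c (some a) - ex c p = (ex c none - ex c p) + (ex c (some a) - ex c none) := by ring
      rw [this, zpow_add]; simp only [mul_assoc]
    rw [e]
    generalize lt x ^ (ex c none - ex c (some (bar a))) * wc c x (mk W) = R at *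
    have h3 := norm_mul_le (lt x ^ (ex c (some a) - ex c p)) ((if a.1 = x.1 then 1 else lt a) * R)
    have h4 := norm_mul_le (if a.1 = x.1 then 1 else lt a) R
    rw [norm_zpow_ex] at h3
    have h5 : (if a.1 = x.1 then 1 else lt a).norm = if a.1 = x.1 then 0 else 1 := by
      split_ifs
      · exact norm_one
      · exact norm_lt _
    rw [h5] at h4
    simp only [T, List.countP_cons, List.length_cons, decide_eq_true_eq]
    split_ifs at * <;> omega

theorem wc_norm (c : Option (α × Bool) → Bool) (x : α × Bool) (h1 : c (some x) = true)
    (h2 : c (some (bar x)) = false) (u : FreeGroup α) :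
    (wc c x u).norm + cnt x.1 u ≤ u.norm + ell (Bc c) u := by
  have := wc_norm_aux c x h1 h2 u.toWord none
  rw [sub_self, zpow_zero, one_mul, mk_toWord] at this
  have h3 := T_le_ell c u
  rw [norm_eq u]; unfold cnt; omega

theorem LM_of (U : List (FreeGroup α))
    (h : ∀ σ : FreeGroup α ≃* FreeGroup α, Small σ → size U ≤ size (U.map σ))
    (c : Option (α × Bool) → Bool) (x : α × Bool) (h1 : c (some x) = true)
    (h2 : c (some (bar x)) = false) : DD x.1 U ≤ LL (Bc c) U := by
  have h0 := h _ (wc_small c x)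
  have : size (U.map (wc c x)) + DD x.1 U ≤ size U + LL (Bc c) U := by
    clear h h0
    unfold size DD LL
    induction U with
    | nil => simp
    | cons u U ih => have := wc_norm c x h1 h2 u; simp only [List.map_cons, List.sum_cons]; omega
  omega

end wh
end MMP

set_option linter.unusedSectionVars false
set_option linter.unusedVariables false
namespace MMP
open FreeGroup hiding map_mul map_inv map_one

section key
variable {α : Type} [DecidableEq α]

def cone (v : List (α × Bool)) : Set (FreeGroup α) := {g | v <+: g.toWord}

def bad (B : Set (FreeGroup α)) : Set (List (α × Bool)) :=
  {v | v ≠ [] ∧ ∃ g : FreeGroup α, v <+: g.toWord ∧ ¬ (g ∈ B ↔ mk v ∈ B)}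

theorem bad_compl (B : Set (FreeGroup α)) : bad Bᶜ = bad B := by
  ext v; simp only [bad, Set.mem_ofPred_eq, Set.mem_compl_iff, not_iff_not]

theorem red_replicate (x : α × Bool) (k : ℕ) : FreeGroup.IsReduced (List.replicate k x) := by
  unfold FreeGroup.IsReduced
  induction k with
  | zero => exact List.IsChain.nil
  | succ k ih =>
    cases k with
    | zero => exact List.IsChain.singleton _
    | succ k =>
      rw [List.replicate_succ, List.replicate_succ, List.isChain_cons_cons]
      exact ⟨fun _ => rfl, ih⟩

theorem lt_pow (x : α × Bool) (k : ℕ) : (lt x) ^ k = mk (List.replicate k x) := by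
  induction k with
  | zero => rfl
  | succ k ih => rw [pow_succ', ih, List.replicate_succ, mk_cons]

theorem toWord_lt_pow (x : α × Bool) (k : ℕ) : ((lt x) ^ k).toWord = List.replicate k x := by
  rw [lt_pow, toWord_mk_red (red_replicate x k)]

theorem switch {p : List (α × Bool) → Prop} (v t : List (α × Bool)) (h : ¬ (p (v ++ t) ↔ p v)) :
    ∃ t1 b t2, t = t1 ++ b :: t2 ∧ ¬ (p (v ++ t1) ↔ p (v ++ t1 ++ [b])) := by
  induction t generalizing v with
  | nil => simp at h
  | cons b t ih =>
    by_cases h1 : p v ↔ p (v ++ [b])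
    · have : ¬ (p ((v ++ [b]) ++ t) ↔ p (v ++ [b])) := by
        rw [← h1]; simpa using h
      obtain ⟨t1, b', t2, h2, h3⟩ := ih _ this
      refine ⟨b :: t1, b', t2, by simp [h2], by simpa using h3⟩
    · exact ⟨[], b, t, rfl, by simpa using h1⟩

theorem bad_finite [Finite α] {B : Set (FreeGroup α)} (hB : AI B) : (bad B).Finite := by
  have : (⋃ b : α × Bool, ⋃ g ∈ E B (lt b), {v | v <+: g.toWord}).Finite := by
    refine Set.finite_iUnion fun b => (hB _).biUnion fun g _ => ?_
    refine (List.finite_toSet g.toWord.inits).subset ?_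
    intro v hv
    simpa using hv
  refine this.subset ?_
  rintro v ⟨hv, g, ⟨t, ht⟩, hg⟩
  have : ¬ (mk (v ++ t) ∈ B ↔ mk v ∈ B) := by rw [ht, mk_toWord]; exact hg
  obtain ⟨t1, b, t2, h1, h2⟩ := switch (p := fun w => mk w ∈ B) v t this
  simp only [Set.mem_iUnion]
  refine ⟨b, mk (v ++ t1), ?_, ?_⟩
  · simp only [E, Set.mem_ofPred_eq]
    rw [mk_append _ [b]] at h2
    exact h2
  · have hr : FreeGroup.IsReduced (v ++ t1) := by
      have : FreeGroup.IsReduced (v ++ t) := by rw [ht]; exact isReduced_toWord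
      rw [h1, ← List.append_assoc] at this
      exact red_left this
    simp only [Set.mem_ofPred_eq, toWord_mk_red hr]
    exact List.prefix_append _ _

theorem cone_eq (v : List (α × Bool)) (a) (hv : FreeGroup.IsReduced (v ++ [a])) :
    cone (v ++ [a]) = tr (mk (v ++ [a])) (H (bar a))ᶜ := by
  ext g
  simp only [cone, tr, H, Set.mem_ofPred_eq, Set.mem_compl_iff]
  constructor
  · rintro ⟨t, ht⟩
    have hr : FreeGroup.IsReduced ((v ++ [a]) ++ t) := by rw [ht]; exact isReduced_toWord
    have : (mk (v ++ [a]))⁻¹ * g = mk t := by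
      rw [← mk_toWord (x := g), ← ht, mk_append _ t, inv_mul_cancel_left]
    rw [this, toWord_mk_red (red_right hr)]
    intro h
    rw [red_append] at hr
    have := hr.2.2
    simp [h] at this
  · intro h
    have hg : g = mk ((v ++ [a]) ++ ((mk (v ++ [a]))⁻¹ * g).toWord) := by
      rw [mk_append _ (toWord _), mk_toWord]; group
    have hr : FreeGroup.IsReduced ((v ++ [a]) ++ ((mk (v ++ [a]))⁻¹ * g).toWord) := by
      rw [red_append]
      refine ⟨hv, isReduced_toWord, ?_⟩
      intro x hx y hy
      simp at hx; subst hx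
      rintro rfl; exact h hy
    refine ⟨_, ((toWord_mk_red hr).symm.trans (congrArg toWord hg.symm))⟩

theorem key_step {U : List (FreeGroup α)}
    (LM : ∀ (c : Option (α × Bool) → Bool) (x : α × Bool), c (some x) = true →
      c (some (bar x)) = false → DD x.1 U ≤ LL (Bc c) U)
    {B : Set (FreeGroup α)} (hB : AI B) (x : α × Bool) (v : List (α × Bool)) (a : α × Bool)
    (hv : v ++ [a] ∈ bad B) (hmax : ∀ w ∈ bad B, w.length ≤ (v ++ [a]).length)
    (ha : mk (v ++ [a] ++ [a]) ∈ B)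
    (h1 : ∃ K, ∀ k ≥ K, lt x ^ k ∈ B) (h2 : ∃ K, ∀ k ≥ K, lt (bar x) ^ k ∉ B) :
    AI (B ∪ cone (v ++ [a])) ∧ LL (B ∪ cone (v ++ [a])) U ≤ LL B U ∧
      bad (B ∪ cone (v ++ [a])) ⊂ bad B ∧
      (∃ K, ∀ k ≥ K, lt x ^ k ∈ B ∪ cone (v ++ [a])) ∧
      (∃ K, ∀ k ≥ K, lt (bar x) ^ k ∉ B ∪ cone (v ++ [a])) := by
  have hred : FreeGroup.IsReduced (v ++ [a]) := by
    obtain ⟨_, g, ⟨t, ht⟩, _⟩ := hv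
    have : FreeGroup.IsReduced (v ++ [a] ++ t) := by rw [ht]; exact isReduced_toWord
    exact red_left this
  have hreda : FreeGroup.IsReduced (v ++ [a] ++ [a]) := by
    rw [red_append]
    refine ⟨hred, red_replicate a 1, ?_⟩
    intro x hx y hy
    simp at hx hy; subst hx; subst hy; exact (bar_ne a).symm
  have hlong : ∀ w, (v ++ [a]).length < w.length → ∀ g : FreeGroup α, w <+: g.toWord →
      (g ∈ B ↔ mk w ∈ B) := by
    intro w hw g hg
    by_contra hc
    have := hmax w ⟨by rintro rfl; simp at hw, g, hg, hc⟩
    omega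
  have hce := cone_eq v a hred
  have hcAI : AI (cone (v ++ [a])) := by rw [hce]; exact ((AI_H _).compl).tr _
  have hcL : LL (cone (v ++ [a])) U ≤ DD a.1 U := by
    rw [hce, LL_tr, LL_compl]; exact LL_H_le (bar a) U
  set V := v ++ [a] with hV
  have hint : DD a.1 U ≤ LL (B ∩ cone V) U := by
    classical
    let c : Option (α × Bool) → Bool := fun o => match o with
      | none => decide (mk V ∈ B)
      | some b => if b = bar a then false else decide (mk (V ++ [b]) ∈ B)
    have hc : B ∩ cone V = tr (mk V) (Bc c) := by
      ext g
      by_cases hg : g ∈ cone V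
      · have hg' := hg
        rw [hce] at hg'
        obtain ⟨t, ht⟩ := hg
        have hr : FreeGroup.IsReduced (V ++ t) := by rw [ht]; exact isReduced_toWord
        have hgt : g = mk (V ++ t) := by rw [ht, mk_toWord]
        have e : (mk V)⁻¹ * g = mk t := by rw [hgt, mk_append V t, inv_mul_cancel_left]
        have : g ∈ cone V := ⟨t, ht⟩
        simp only [Set.mem_inter_iff, this, and_true]
        simp only [tr, H, Set.mem_ofPred_eq, Set.mem_compl_iff, Bc, e,
          toWord_mk_red (red_right hr)] at hg' ⊢
        cases t with
        | nil => rw [hgt]; simp [c]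
        | cons b t =>
          have hb : b ≠ bar a := by rintro rfl; simp at hg'
          simp only [List.head?_cons, c, if_neg hb, decide_eq_true_eq]
          apply hlong
          · simp
          · rw [← ht]; exact ⟨t, by simp⟩
      · simp only [Set.mem_inter_iff, hg, and_false, false_iff]
        rw [hce] at hg
        simp only [tr, H, Set.mem_ofPred_eq, Set.mem_compl_iff, not_not, Bc] at hg ⊢
        rw [hg]; simp [c]
    rw [hc, LL_tr]
    apply LM
    · simp only [c, if_neg (bar_ne a).symm, decide_eq_true_eq]; exact ha
    · simp [c]
  refine ⟨hB.union hcAI, ?_, ?_, ?_, ?_⟩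
  · have := LL_submod hB hcAI U; omega
  · rw [Set.ssubset_iff_of_subset]
    · refine ⟨V, hv, ?_⟩
      rintro ⟨_, g, hg, hgn⟩
      apply hgn
      have h1 : g ∈ cone V := hg
      have h2 : mk V ∈ cone V := by
        simp only [cone, Set.mem_ofPred_eq, toWord_mk_red hred]; exact List.prefix_refl _
      exact ⟨fun _ => Or.inr h2, fun _ => Or.inr h1⟩
    · rintro w ⟨hw, g, hg, hgn⟩
      have hwr : FreeGroup.IsReduced w := by
        obtain ⟨t, ht⟩ := hg
        have : FreeGroup.IsReduced (w ++ t) := by rw [ht]; exact isReduced_toWord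
        exact red_left this
      refine ⟨hw, ?_⟩
      have hwc : mk w ∉ cone V := by
        intro hwc
        have hwc' := hwc
        simp only [cone, Set.mem_ofPred_eq, toWord_mk_red hwr] at hwc'
        have : g ∈ cone V := hwc'.trans hg
        exact hgn ⟨fun _ => Or.inr hwc, fun _ => Or.inr this⟩
      by_cases hgc : g ∈ cone V
      · have hwB : mk w ∉ B := fun h => hgn ⟨fun _ => Or.inl h, fun _ => Or.inr hgc⟩
        have hpre : w <+: V := by
          rcases List.prefix_or_prefix_of_prefix hg hgc with h | h
          · exact h
          · exfalso; apply hwc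
            simp only [cone, Set.mem_ofPred_eq, toWord_mk_red hwr]; exact h
        refine ⟨mk (V ++ [a]), ?_, fun h => hwB (h.1 ha)⟩
        rw [toWord_mk_red hreda]
        exact hpre.trans (List.prefix_append _ _)
      · refine ⟨g, hg, ?_⟩
        simp only [Set.mem_union, hgc, hwc, or_false] at hgn
        exact hgn
  · obtain ⟨K, hK⟩ := h1
    exact ⟨K, fun k hk => Or.inl (hK k hk)⟩
  · obtain ⟨K, hK⟩ := h2
    refine ⟨max K (V.length + 1), fun k hk => ?_⟩
    have hk1 : K ≤ k := le_trans (le_max_left _ _) hk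
    have hk2 : V.length + 1 ≤ k := le_trans (le_max_right _ _) hk
    rintro (h | h)
    · exact hK k hk1 h
    · simp only [cone, Set.mem_ofPred_eq, toWord_lt_pow] at h
      have hax : V = List.replicate V.length (bar x) := by
        rw [List.eq_replicate_iff]
        refine ⟨rfl, fun b hb => List.eq_of_mem_replicate (h.subset hb)⟩
      have hax2 : a = bar x := List.eq_of_mem_replicate (h.subset (by simp [hV]))
      have hp : V ++ [a] <+: (lt (bar x) ^ k).toWord := by
        rw [toWord_lt_pow, hax2, hax]
        refine ⟨List.replicate (k - (V.length + 1)) (bar x), ?_⟩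
        rw [← List.replicate_succ', ← List.replicate_add]
        congr 1; omega
      have := hlong (V ++ [a]) (by simp) _ hp
      exact hK k hk1 (this.2 ha)

theorem key [Finite α] {U : List (FreeGroup α)}
    (LM : ∀ (c : Option (α × Bool) → Bool) (x : α × Bool), c (some x) = true →
      c (some (bar x)) = false → DD x.1 U ≤ LL (Bc c) U) (N : ℕ) :
    ∀ (B : Set (FreeGroup α)) (hB : AI B) (x : α × Bool) (hN : (bad B).ncard = N)
    (h1 : ∃ K, ∀ k ≥ K, lt x ^ k ∈ B) (h2 : ∃ K, ∀ k ≥ K, lt (bar x) ^ k ∉ B),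
    DD x.1 U ≤ LL B U := by
  induction N using Nat.strong_induction_on with
  | _ N ih =>
  intro B hB x hN h1 h2
  have hfin := bad_finite hB
  rcases Set.eq_empty_or_nonempty (bad B) with he | hne
  · classical
    let c : Option (α × Bool) → Bool := fun o => match o with
      | none => decide ((1 : FreeGroup α) ∈ B)
      | some b => decide (lt b ∈ B)
    have hc : ∀ g, g ∈ B ↔ c g.toWord.head? = true := by
      intro g
      cases hw : g.toWord with
      | nil =>
        have : g = 1 := toWord_eq_nil_iff.1 hw
        subst this; simp [c]
      | cons b t =>
        simp only [List.head?_cons, c, decide_eq_true_eq]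
        by_contra hcc
        have : [b] ∈ bad B := ⟨by simp, g, by rw [hw]; simp, hcc⟩
        rw [he] at this; exact this
    have hBc : B = Bc c := by ext g; exact hc g
    rw [hBc]
    apply LM
    · obtain ⟨K, hK⟩ := h1
      have := (hc _).1 (hK (K + 1) (by omega))
      rwa [toWord_lt_pow, List.replicate_succ, List.head?_cons] at this
    · obtain ⟨K, hK⟩ := h2
      have := (not_congr (hc _)).1 (hK (K + 1) (by omega))
      rw [toWord_lt_pow, List.replicate_succ, List.head?_cons] at this
      simpa using this
  · obtain ⟨v, hv, hmax⟩ := Set.exists_max_image (bad B) List.length hfin hne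
    have hvne : v ≠ [] := hv.1
    obtain ⟨v', a, rfl⟩ : ∃ v' a, v = v' ++ [a] :=
      ⟨v.dropLast, v.getLast hvne, (List.dropLast_append_getLast hvne).symm⟩
    by_cases ha : mk (v' ++ [a] ++ [a]) ∈ B
    · obtain ⟨q1, q2, q3, q4, q5⟩ := key_step LM hB x v' a hv hmax ha h1 h2
      exact (ih _ (hN ▸ Set.ncard_lt_ncard q3 hfin) _ q1 x rfl q4 q5).trans q2
    · rw [← bad_compl] at hv hmax
      have h1' : ∃ K, ∀ k ≥ K, lt (bar (bar x)) ^ k ∉ Bᶜ := by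
        obtain ⟨K, hK⟩ := h1
        exact ⟨K, fun k hk => by rw [bar_bar]; exact fun h => h (hK k hk)⟩
      obtain ⟨q1, q2, q3, q4, q5⟩ := key_step LM hB.compl (bar x) v' a hv hmax ha h2 h1'
      rw [bad_compl] at q3
      rw [LL_compl] at q2
      exact (ih _ (hN ▸ Set.ncard_lt_ncard q3 hfin) _ q1 (bar x) rfl q4 q5).trans q2

end key
end MMP

set_option linter.unusedSectionVars false
set_option linter.unusedVariables false
namespace MMP
open FreeGroup hiding map_mul map_inv map_one

section w1
variable {α : Type} [DecidableEq α]

/-- exponent sum -/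
def expo (y : α) : FreeGroup α →* Multiplicative ℤ :=
  lift (fun i => Multiplicative.ofAdd (if i = y then 1 else 0))

theorem expo_lt (y : α) (b : α × Bool) (h : b.1 ≠ y) : expo y (lt b) = 1 := by
  obtain ⟨b, e⟩ := b
  cases e
  · rw [lt_false, map_inv, expo, lift_apply_of, if_neg h]; rfl
  · rw [lt_true, expo, lift_apply_of, if_neg h]; rfl

theorem expo_mk (y : α) (R : List (α × Bool)) (h : ∀ b ∈ R, b.1 ≠ y) : expo y (mk R) = 1 := by
  induction R with
  | nil => exact map_one _
  | cons b R ih =>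
    rw [mk_cons, map_mul, expo_lt y b (h b (by simp)), ih (fun b hb => h b (by simp [hb]))]; rfl

theorem head_mul_of_norm {g h : FreeGroup α} (hn : h.norm < g.norm) :
    (g * h).toWord.head? = g.toWord.head? := by
  obtain ⟨s, q, t, h1, h2, h3⟩ := cancel g h
  rw [h3, h1]
  rw [norm_eq, norm_eq, h1, h2] at hn
  cases s with
  | nil => simp at hn
  | cons a s => rfl

theorem mk_flatten_replicate (R : List (α × Bool)) (k : ℕ) :
    mk (List.replicate k R).flatten = mk R ^ k := by
  induction k with
  | zero => rfl
  | succ k ih => rw [List.replicate_succ, List.flatten_cons, mk_append, ih, pow_succ']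

theorem cyc_pow {R : List (α × Bool)} (h : IsCyclicallyReduced R) (k : ℕ) :
    (mk R ^ k).toWord = (List.replicate k R).flatten := by
  rw [← mk_flatten_replicate, toWord_mk_red (h.flatten_replicate k).isReduced]

theorem cyc_head {R : List (α × Bool)} (h : IsCyclicallyReduced R) (hR : R ≠ [])
    (d : FreeGroup α) (k : ℕ) (hk : d.norm < k) :
    (mk R ^ k * d).toWord.head? = R.head? := by
  rw [head_mul_of_norm]
  · rw [cyc_pow h]
    obtain ⟨k, rfl⟩ : ∃ j, k = j + 1 := ⟨k - 1, by omega⟩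
    rw [List.replicate_succ, List.flatten_cons]
    cases R with
    | nil => exact absurd rfl hR
    | cons a R => rfl
  · rw [norm_eq (_ ^ _), cyc_pow h]
    have : 1 ≤ R.length := List.length_pos_iff.2 hR
    simp only [List.length_flatten, List.map_replicate, List.sum_replicate, smul_eq_mul]
    nlinarith

theorem cyc_inv {R : List (α × Bool)} (h : IsCyclicallyReduced R) :
    IsCyclicallyReduced (invRev R) := by
  refine ⟨red_invRev h.1, ?_⟩
  have h2 := h.2
  intro a ha b hb
  simp only [invRev_eq, List.getLast?_reverse, List.head?_reverse, List.head?_map,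
    List.getLast?_map, Option.mem_def, Option.map_eq_some_iff] at ha hb
  obtain ⟨a', ha', rfl⟩ := ha
  obtain ⟨b', hb', rfl⟩ := hb
  have := h2 b' hb' a' ha'
  simp only [bar]; intro h'; rw [this h'.symm]

theorem cyc_rot {r1 r2 : List (α × Bool)} {a : α × Bool} (h : IsCyclicallyReduced (r1 ++ a :: r2)) :
    IsCyclicallyReduced (a :: (r2 ++ r1)) := by
  have h3 := (h.flatten_replicate 3).isReduced
  have e : (List.replicate 3 (r1 ++ a :: r2)).flatten =
    r1 ++ ((a :: (r2 ++ r1) ++ [a]) ++ (r2 ++ (r1 ++ a :: r2))) := by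
    simp [List.replicate_succ]
  rw [e] at h3
  have h4 := red_left (red_right h3)
  refine ⟨red_left h4, ?_⟩
  rw [red_append] at h4
  intro x hx y hy
  have := h4.2.2 x hx a (by simp)
  simp at hy; subst hy
  exact rel_iff.2 this

theorem sep (y : α) (w : FreeGroup α) (h : expo y w ≠ 1) :
    ∃ (a : α × Bool) (d : FreeGroup α), a.1 = y ∧
      (∃ K, ∀ k ≥ K, d * w ^ k ∈ H a) ∧ (∃ K, ∀ k ≥ K, d * w⁻¹ ^ k ∉ H a) := by
  set R := reduceCyclically w.toWord
  set C := reduceCyclically.conjugator w.toWord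
  have hw : w = mk C * mk R * (mk C)⁻¹ := by
    have := reduceCyclically.conj_conjugator_reduceCyclically w.toWord
    rw [inv_mk, ← mk_append, ← mk_append, this, mk_toWord]
  have hR : IsCyclicallyReduced R := reduceCyclically.isCyclicallyReduced isReduced_toWord
  have hl : ∃ a ∈ R, a.1 = y := by
    by_contra hc
    push Not at hc
    apply h
    rw [hw, map_mul, map_mul, map_inv, expo_mk y R hc]; simp
  obtain ⟨a, haR, hay⟩ := hl
  obtain ⟨r1, r2, hr⟩ := List.append_of_mem haR
  rw [hr] at hR
  have hc := cyc_rot hR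
  set R' := a :: (r2 ++ r1) with hR'
  have hw' : w = mk (C ++ r1) * mk R' * (mk (C ++ r1))⁻¹ := by
    rw [hw, hr, hR', mk_cons, mk_append, mk_append, mk_append, mk_cons]; group
  set d := mk (C ++ r1)
  refine ⟨a, d⁻¹, hay, ⟨d⁻¹.norm + 1, fun k hk => ?_⟩, ⟨d⁻¹.norm + 1, fun k hk => ?_⟩⟩
  · have e : d⁻¹ * w ^ k = mk R' ^ k * d⁻¹ := by rw [hw', conj_pow]; group
    simp only [H, Set.mem_ofPred_eq]
    rw [e, cyc_head hc (by simp [hR']) _ _ hk]; rfl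
  · have e : d⁻¹ * w⁻¹ ^ k = mk (invRev R') ^ k * d⁻¹ := by
      have : w⁻¹ = d * mk (invRev R') * d⁻¹ := by rw [hw', ← inv_mk]; group
      rw [this, conj_pow]; group
    simp only [H, Set.mem_ofPred_eq]
    rw [e, cyc_head (cyc_inv hc) _ _ _ hk]
    · intro h'
      rw [invRev_eq, List.head?_reverse, List.getLast?_map, Option.map_eq_some_iff] at h'
      obtain ⟨b, hb, hba⟩ := h'
      have := hc.2 b hb a (by simp [hR'])
      rw [← hba] at this
      have := this rfl
      simp [bar] at this
    · intro h'; have := congrArg List.length h'; simp [invRev_length, hR'] at this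

theorem DD_le [Finite α] (U : List (FreeGroup α))
    (h : ∀ σ : FreeGroup α ≃* FreeGroup α, Small σ → size U ≤ size (U.map σ))
    (f : FreeGroup α ≃* FreeGroup α) (x y : α) (hxy : expo y (f (of x)) ≠ 1) :
    DD x U ≤ DD y (U.map f) := by
  obtain ⟨a, d, hay, h1, h2⟩ := sep y _ hxy
  have hAI : AI (f ⁻¹' (tr d⁻¹ (H a))) := ((AI_H a).tr _).pull f
  have e : ∀ g, g ∈ f ⁻¹' (tr d⁻¹ (H a)) ↔ d * f g ∈ H a := by
    intro g; simp [tr]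
  have := key (fun c x => LM_of U h c x) _ _ hAI (x, true) rfl
    (by obtain ⟨K, hK⟩ := h1
        refine ⟨K, fun k hk => ?_⟩
        rw [e, map_pow, lt_true]; exact hK k hk)
    (by obtain ⟨K, hK⟩ := h2
        refine ⟨K, fun k hk => ?_⟩
        rw [e, map_pow, lt_bar, lt_true, map_inv]; exact hK k hk)
  refine this.trans ?_
  have e2 : LL (f ⁻¹' (tr d⁻¹ (H a))) U = LL (H a) (U.map f) := by
    unfold LL; rw [List.map_map]; congr 1; apply List.map_congr_left
    intro u _; rw [ell_pull, ell_tr]; rfl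
  rw [e2, ← hay]
  exact LL_H_le _ _

/-- abelianization matrix -/
def abM (f : FreeGroup α →* FreeGroup α) : Matrix α α ℤ :=
  fun y x => Multiplicative.toAdd (expo y (f (of x)))

theorem abM_mul [Fintype α] (f g : FreeGroup α →* FreeGroup α) : abM f * abM g = abM (f.comp g) := by
  ext y x
  rw [Matrix.mul_apply]
  simp only [abM, MonoidHom.comp_apply]
  generalize g (of x) = u
  induction u using word_induction with
  | h1 => simp
  | h l u ih =>
    simp only [map_mul, toAdd_mul, mul_add, Finset.sum_add_distrib, ih]
    congr 1
    obtain ⟨i, e⟩ := l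
    have : ∀ j, Multiplicative.toAdd (expo j (of i)) = if i = j then 1 else 0 := by
      intro j; rw [expo, lift_apply_of]; rfl
    cases e
    · rw [lt_false]; simp [map_inv, this]
    · rw [lt_true]; simp [this]

theorem abM_id : abM (MonoidHom.id (FreeGroup α)) = 1 := by
  ext y x
  simp only [abM, MonoidHom.id_apply, expo, lift_apply_of, toAdd_ofAdd, Matrix.one_apply, eq_comm]

theorem exists_perm [Fintype α] (f : FreeGroup α ≃* FreeGroup α) :
    ∃ π : Equiv.Perm α, ∀ x, expo (π x) (f (of x)) ≠ 1 := by
  have h : abM f.toMonoidHom * abM f.symm.toMonoidHom = 1 := by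
    rw [abM_mul, ← abM_id]; congr 1; ext; simp
  have hdet : (abM f.toMonoidHom).det ≠ 0 := by
    intro h0
    have := congrArg Matrix.det h
    rw [Matrix.det_mul, h0] at this; simp at this
  rw [Matrix.det_apply] at hdet
  obtain ⟨π, _, hπ⟩ := Finset.exists_ne_zero_of_sum_ne_zero hdet
  refine ⟨π, fun x hx => hπ ?_⟩
  rw [Finset.prod_eq_zero (Finset.mem_univ x), smul_zero]
  exact hx

theorem W1' [Fintype α] (U : List (FreeGroup α))
    (h : ∀ σ : FreeGroup α ≃* FreeGroup α, Small σ → size U ≤ size (U.map σ))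
    (f : FreeGroup α ≃* FreeGroup α) : size U ≤ size (U.map f) := by
  obtain ⟨π, hπ⟩ := exists_perm f
  rw [← sum_DD U, ← sum_DD (U.map f), ← Equiv.sum_comp π (fun y => DD y (U.map f))]
  exact Finset.sum_le_sum fun x _ => DD_le U h f _ _ (hπ x)

theorem W1 [Fintype α] (U : List (FreeGroup α)) (f : FreeGroup α ≃* FreeGroup α)
    (hf : size (U.map f) < size U) :
    ∃ σ : FreeGroup α ≃* FreeGroup α, Small σ ∧ size (U.map σ) < size U := by
  by_contra hc
  push Not at hc
  have := W1' U hc f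
  omega

end w1
end MMP

set_option linter.unusedSectionVars false
set_option linter.unusedVariables false
namespace MMP
open FreeGroup hiding map_mul map_inv map_one

section w2
variable {α : Type} [DecidableEq α]

def Stp (N : ℕ) (a b : List (FreeGroup α)) : Prop :=
  size a ≤ N ∧ size b ≤ N ∧ ∃ σ : FreeGroup α ≃* FreeGroup α, Small σ ∧ b = a.map σ

theorem Small.symm {σ : FreeGroup α ≃* FreeGroup α} (h : Small σ) : Small σ.symm :=
  fun i => ⟨(h i).2, (h i).1⟩

theorem Stp.symm {N : ℕ} {a b : List (FreeGroup α)} (h : Stp N a b) : Stp N b a := by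
  obtain ⟨h1, h2, σ, hσ, rfl⟩ := h
  refine ⟨h2, h1, σ.symm, hσ.symm, ?_⟩
  rw [List.map_map]; symm
  convert List.map_id a using 2
  ext1 x; simp

theorem Stp.mono {N M : ℕ} (hNM : N ≤ M) {a b : List (FreeGroup α)} (h : Stp N a b) : Stp M a b :=
  ⟨h.1.trans hNM, h.2.1.trans hNM, h.2.2⟩

theorem size_append (A B : List (FreeGroup α)) : size (A ++ B) = size A + size B := by
  simp [size]

theorem size_rep (N : ℕ) (A : List (FreeGroup α)) :
    size (List.replicate N A).flatten = N * size A := by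
  induction N with
  | zero => simp [size]
  | succ N ih => rw [List.replicate_succ, List.flatten_cons, size_append, ih]; ring

/-- size of the inverse -/
def invSize [Fintype α] (f : FreeGroup α ≃* FreeGroup α) : ℕ := ∑ i, (f.symm (of i)).norm

theorem perm_small [Fintype α] (f : FreeGroup α ≃* FreeGroup α) (h : invSize f ≤ Fintype.card α) :
    Small f := by
  have h1 : ∀ i, 1 ≤ (f.symm (of i)).norm := by
    intro i
    rw [Nat.one_le_iff_ne_zero, Ne, FreeGroup.norm_eq_zero, EmbeddingLike.map_eq_one_iff]
    exact of_ne_one i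
  have h2 : ∀ i, (f.symm (of i)).norm = 1 := by
    by_contra hc
    push Not at hc
    obtain ⟨i, hi⟩ := hc
    have : ∑ i : α, 1 < ∑ i, (f.symm (of i)).norm :=
      Finset.sum_lt_sum (fun i _ => h1 i) ⟨i, Finset.mem_univ i, lt_of_le_of_ne (h1 i) (Ne.symm hi)⟩
    simp at this; unfold invSize at h; omega
  have h3 : ∀ i, ∃ b, f.symm (of i) = lt b := by
    intro i
    have := h2 i
    rw [norm_eq, List.length_eq_one_iff] at this
    obtain ⟨b, hb⟩ := this
    exact ⟨b, toWord_injective hb⟩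
  choose b hb using h3
  have hfb : ∀ i, f (of (b i).1) = of i ∨ f (of (b i).1) = (of i)⁻¹ := by
    intro i
    have : f (lt (b i)) = of i := by rw [← hb]; simp
    cases hbi : b i with
    | mk j e =>
      rw [hbi] at this
      cases e
      · right; rw [lt_false, map_inv] at this; rw [← this, inv_inv]
      · left; exact this
  have key : ∀ (i i' : α), (of i : FreeGroup α) = (of i')⁻¹ → i = i' := by
    intro i i' h
    rw [← lt_false, ← lt_true] at h
    have := lt_injective h; simp at this
  have hinj : Function.Injective (fun i => (b i).1) := by
    intro i i' hii
    simp only at hii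
    have h1 := hfb i
    have h2 := hfb i'
    rw [hii] at h1
    rcases h1 with h1 | h1 <;> rcases h2 with h2 | h2 <;> rw [h1] at h2
    · exact of_injective h2
    · exact key _ _ h2
    · exact (key _ _ h2.symm).symm
    · exact of_injective (inv_injective h2)
  have hsurj := Finite.surjective_of_injective hinj
  intro j
  refine ⟨?_, by rw [h2]; omega⟩
  obtain ⟨i, hi⟩ := hsurj j
  simp only at hi
  rw [← hi]
  rcases hfb i with h | h
  · rw [h, norm_of]; omega
  · rw [h, norm_inv_eq, norm_of]; omega

theorem W2 [Fintype α] (s M : ℕ) : ∀ (u : List (FreeGroup α)) (f : FreeGroup α ≃* FreeGroup α)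
    (hs : size u = s) (hM : invSize f = M)
    (hmin : ∀ g : FreeGroup α ≃* FreeGroup α, size (u.map f) ≤ size (u.map g)),
    Relation.ReflTransGen (Stp s) u (u.map f) := by
  induction s using Nat.strong_induction_on generalizing M with
  | _ s ihs =>
  induction M using Nat.strong_induction_on with
  | _ M ihM =>
  intro u f hs hM hmin
  have hle : size (u.map f) ≤ size u := by
    have := hmin (MulEquiv.refl _)
    simpa using this
  set I : List (FreeGroup α) := Finset.univ.toList.map (fun i => f.symm (of i)) with hI
  have hsz : ∀ g : FreeGroup α ≃* FreeGroup α, size (I.map g) = ∑ i, (g (f.symm (of i))).norm := by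
    intro g
    rw [hI, size, List.map_map, List.map_map, Finset.sum_map_toList]; rfl
  have hszI : size I = M := by
    rw [← hM, hI, size, List.map_map, Finset.sum_map_toList]; rfl
  have hszU : ∀ g : FreeGroup α ≃* FreeGroup α,
      size (((List.replicate (M+1) u).flatten ++ I).map g) =
      (M+1) * size (u.map g) + ∑ i, (g (f.symm (of i))).norm := by
    intro g
    rw [List.map_append, size_append, hsz, List.map_flatten, List.map_replicate, size_rep]
  have hszU0 : size ((List.replicate (M+1) u).flatten ++ I) = (M+1) * size u + M := by
    rw [size_append, size_rep, hszI]
  by_cases hlt : size (((List.replicate (M+1) u).flatten ++ I).map f) <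
      size ((List.replicate (M+1) u).flatten ++ I)
  · obtain ⟨σ, hσ, hlt'⟩ := W1 _ f hlt
    rw [hszU, hszU0] at hlt'
    have h1 : size (u.map σ) ≤ size u := by
      by_contra hc
      have : (M+1) * (size u + 1) ≤ (M+1) * size (u.map σ) := Nat.mul_le_mul_left _ (by omega)
      rw [mul_add (M+1), mul_one] at this
      omega
    have hmap : (u.map σ).map (σ.symm.trans f) = u.map f := by
      rw [List.map_map]; apply List.map_congr_left; intro x _; simp
    have hstep : Stp s u (u.map σ) := ⟨hs.le, hs ▸ h1, σ, hσ, rfl⟩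
    have hmin' : ∀ g : FreeGroup α ≃* FreeGroup α,
        size ((u.map σ).map (σ.symm.trans f)) ≤ size ((u.map σ).map g) := by
      intro g
      rw [hmap]
      rw [List.map_map]
      exact hmin (σ.trans g)
    have hinv : invSize (σ.symm.trans f) = ∑ i, (σ (f.symm (of i))).norm := rfl
    rcases h1.lt_or_eq with h2 | h2
    · have := ihs (size (u.map σ)) (hs ▸ h2) _ (u.map σ) (σ.symm.trans f) rfl rfl hmin'
      rw [hmap] at this
      exact Relation.ReflTransGen.head hstep (Relation.ReflTransGen.mono (fun a b h => Stp.mono (hs ▸ h1) h) _ _ this)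
    · have := ihM (invSize (σ.symm.trans f)) (by rw [hinv]; rw [h2] at hlt'; omega) (u.map σ)
        (σ.symm.trans f) (h2.trans hs) rfl hmin'
      rw [hmap] at this
      exact Relation.ReflTransGen.head hstep this
  · rw [hszU, hszU0] at hlt
    have hcard : ∑ i : α, (f (f.symm (of i))).norm = Fintype.card α := by simp
    rw [hcard] at hlt
    have : (M+1) * size (u.map f) ≤ (M+1) * size u := Nat.mul_le_mul_left _ hle
    refine Relation.ReflTransGen.single ⟨hs.le, hs ▸ hle, f, perm_small f ?_, rfl⟩
    omega

theorem W3 [Fintype α] (u : List (FreeGroup α)) (f : FreeGroup α ≃* FreeGroup α) :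
    Relation.ReflTransGen (Stp (max (size u) (size (u.map f)))) u (u.map f) := by
  obtain ⟨g, -, hg⟩ := WellFounded.has_min (measure (fun g : FreeGroup α ≃* FreeGroup α =>
    size (u.map g))).wf Set.univ ⟨MulEquiv.refl _, trivial⟩
  have hg' : ∀ k : FreeGroup α ≃* FreeGroup α, size (u.map g) ≤ size (u.map k) :=
    fun k => not_lt.1 (hg k trivial)
  have h1 := W2 _ _ u g rfl rfl hg'
  have hmap : (u.map f).map (f.symm.trans g) = u.map g := by
    rw [List.map_map]; apply List.map_congr_left; intro x _; simp
  have h2 := W2 _ _ (u.map f) (f.symm.trans g) rfl rfl (by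
    intro k; rw [hmap, List.map_map]; exact hg' (f.trans k))
  rw [hmap] at h2
  refine (Relation.ReflTransGen.mono (fun a b h => Stp.mono (le_max_left _ _) h) _ _ h1).trans ?_
  have : Std.Symm (Stp (α := α) (max (size u) (size (u.map f)))) := ⟨fun a b h => h.symm⟩
  exact Relation.ReflTransGen.stdSymm.symm _ _
    (Relation.ReflTransGen.mono (fun a b h => Stp.mono (le_max_right _ _) h) _ _ h2)

end w2
end MMP

set_option linter.unusedSectionVars false
set_option linter.unusedVariables false
namespace MMP
open FreeGroup hiding map_mul map_inv map_one

section nred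
variable {α : Type} [DecidableEq α]

/-- cancellation between `g` and `h` -/
def cc (g h : FreeGroup α) : ℕ := lcp g⁻¹.toWord h.toWord

theorem cc_norm (g h : FreeGroup α) : (g * h).norm + 2 * cc g h = g.norm + h.norm := norm_lcp g h

theorem cc_symm (g h : FreeGroup α) : cc h⁻¹ g⁻¹ = cc g h := by
  unfold cc; rw [inv_inv, lcp_comm]

/-- Nielsen condition on a set of generators -/
def N2 (z : FreeGroup α →* FreeGroup α) (S : Set α) : Prop :=
  ∀ a b c : α × Bool, a.1 ∈ S → b.1 ∈ S → c.1 ∈ S → a ≠ bar b → b ≠ bar c →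
    cc (z (lt a)) (z (lt b)) + cc (z (lt b)) (z (lt c)) < (z (lt b)).norm

theorem lcp_ge (g h : FreeGroup α) : g.norm ≤ lcp g.toWord (g * h).toWord + cc g h := by
  obtain ⟨s, q, t, h1, h2, h3⟩ := cancel g h
  have h4 := cc_norm g h
  rw [norm_eq, norm_eq, norm_eq, h1, h2, h3] at h4
  rw [norm_eq, h1, h3]
  simp only [List.length_append, invRev_length] at *
  have : s.length ≤ lcp (s ++ invRev q) (s ++ t) := by
    clear h1 h3 h4
    induction s with
    | nil => simp
    | cons a s ih => simp [lcp]; exact ih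
  omega

theorem glob1 {z : FreeGroup α →* FreeGroup α} {S : Set α} (hN : N2 z S) (W : List (α × Bool)) :
    ∀ a b, a.1 ∈ S → a ≠ bar b → FreeGroup.IsReduced (b :: W) → (∀ l ∈ b :: W, l.1 ∈ S) →
    cc (z (lt a)) (z (mk (b :: W))) = cc (z (lt a)) (z (lt b)) := by
  induction W with
  | nil => intro a b _ _ _ _; rfl
  | cons c W ih =>
    intro a b ha hab hr hS
    have hb : b.1 ∈ S := hS b (by simp)
    have hc : c.1 ∈ S := hS c (by simp)
    rw [red_cons] at hr
    have hbc : c ≠ bar b := by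
      intro h; exact hr.2 c (by simp) h
    have hbc' : b ≠ bar c := by rintro rfl; simp at hbc
    have h1 := ih b c hb hbc' hr.1 (fun l hl => hS l (by simp [hl]))
    have h2 := hN a b c ha hb hc hab hbc'
    have h3 := lcp_ge (z (lt b)) (z (mk (c :: W)))
    rw [h1] at h3
    rw [mk_cons b, map_mul]
    set Y := (z (lt b) * z (mk (c :: W))).toWord
    have u1 := lcp_ultra (z (lt a))⁻¹.toWord (z (lt b)).toWord Y
    have u2 := lcp_ultra (z (lt a))⁻¹.toWord Y (z (lt b)).toWord
    rw [lcp_comm Y] at u2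
    change lcp (z (lt a))⁻¹.toWord Y = lcp (z (lt a))⁻¹.toWord (z (lt b)).toWord
    unfold cc at *
    omega

theorem norm_cons {z : FreeGroup α →* FreeGroup α} {S : Set α} (hN : N2 z S) (W : List (α × Bool))
    (b c : α × Bool) (hr : FreeGroup.IsReduced (b :: c :: W)) (hS : ∀ l ∈ b :: c :: W, l.1 ∈ S) :
    (z (mk (b :: c :: W))).norm + 2 * cc (z (lt b)) (z (lt c)) =
      (z (lt b)).norm + (z (mk (c :: W))).norm := by
  have hr' := red_cons.1 hr
  have hbc : c ≠ bar b := hr'.2 c (by simp)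
  have hbc' : b ≠ bar c := by rintro rfl; simp at hbc
  rw [← glob1 hN W b c (hS b (by simp)) hbc' hr'.1 (fun l hl => hS l (by simp [hl])),
    mk_cons, map_mul]
  exact cc_norm _ _

theorem glob2 {z : FreeGroup α →* FreeGroup α} {S : Set α} (hN : N2 z S) (W : List (α × Bool)) :
    ∀ a b, a.1 ∈ S → a ≠ bar b → FreeGroup.IsReduced (b :: W) → (∀ l ∈ b :: W, l.1 ∈ S) →
    cc (z (lt a)) (z (lt b)) + (b :: W).length ≤ (z (mk (b :: W))).norm := by
  induction W with
  | nil =>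
    intro a b ha hab _ hS
    have hb := hS b (by simp)
    have := hN a b b ha hb hb hab (bar_ne b).symm
    change _ ≤ (z (lt b)).norm
    simp; omega
  | cons c W ih =>
    intro a b ha hab hr hS
    have hr' := red_cons.1 hr
    have hbc : c ≠ bar b := hr'.2 c (by simp)
    have hbc' : b ≠ bar c := by rintro rfl; simp at hbc
    have hb := hS b (by simp)
    have hc := hS c (by simp)
    have h1 := norm_cons hN W b c hr hS
    have h2 := ih b c hb hbc' hr'.1 (fun l hl => hS l (by simp [hl]))
    have h3 := hN a b c ha hb hc hab hbc'
    simp only [List.length_cons] at *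
    omega

theorem glob3 {z : FreeGroup α →* FreeGroup α} {S : Set α} (hN : N2 z S) (W : List (α × Bool))
    (hr : FreeGroup.IsReduced W) (hS : ∀ l ∈ W, l.1 ∈ S) : W.length ≤ (z (mk W)).norm := by
  cases W with
  | nil => simp
  | cons b W =>
    have := glob2 hN W b b (hS b (by simp)) (bar_ne b).symm hr hS
    omega

theorem inj_of_N2 {z : FreeGroup α →* FreeGroup α} {S : Set α} (hN : N2 z S) (g : FreeGroup α)
    (hS : ∀ l ∈ g.toWord, l.1 ∈ S) (h : z g = 1) : g = 1 := by
  have := glob3 hN g.toWord isReduced_toWord hS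
  rw [mk_toWord, h, FreeGroup.norm_one] at this
  exact toWord_eq_nil_iff.1 (List.length_eq_zero_iff.1 (by omega))

theorem glob4 {z : FreeGroup α →* FreeGroup α} (hN : N2 z Set.univ)
    (hN1 : ∀ a b : α × Bool, a ≠ bar b → 2 * cc (z (lt a)) (z (lt b)) ≤ (z (lt b)).norm)
    (hN1' : ∀ a b : α × Bool, a ≠ bar b → 2 * cc (z (lt a)) (z (lt b)) ≤ (z (lt a)).norm)
    (W : List (α × Bool)) (hr : FreeGroup.IsReduced W) :
    ∀ x ∈ W, (z (lt x)).norm ≤ (z (mk W)).norm := by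
  induction W with
  | nil => simp
  | cons b W ih =>
    cases W with
    | nil => intro x hx; simp at hx; subst hx; exact le_refl _
    | cons c W =>
      have hr' := red_cons.1 hr
      have hbc : c ≠ bar b := hr'.2 c (by simp)
      have hbc' : b ≠ bar c := by rintro rfl; simp at hbc
      have h1 := norm_cons hN W b c hr (by simp)
      have h2 := ih hr'.1
      have h3 := hN1 b c hbc'
      have h4 := hN1' b c hbc'
      have h5 := h2 c (by simp)
      intro x hx
      rcases List.mem_cons.1 hx with rfl | hx
      · omega
      · have := h2 x hx; omega

theorem sq_norm (g : FreeGroup α) (hg : g ≠ 1) : 2 * cc g g < g.norm := by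
  have h1 := cc_norm g g
  have h2 := reduceCyclically.reduce_flatten_replicate_succ (isReduced_toWord (x := g)) 1
  have h3 := reduceCyclically.conj_conjugator_reduceCyclically g.toWord
  have h4 : (g * g).toWord = reduce (List.replicate (1 + 1) g.toWord).flatten := by
    rw [← toWord_mk, mk_flatten_replicate, mk_toWord, pow_two]
  rw [← h4] at h2
  have h5 := congrArg List.length h2
  have h6 := congrArg List.length h3
  have h7 : reduceCyclically g.toWord ≠ [] := by
    intro h
    apply hg
    rw [h] at h3
    rw [← mk_toWord (x := g), ← h3, List.append_nil, mk_append, ← inv_mk, mul_inv_cancel]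
  have h8 := List.length_pos_iff.2 h7
  rw [← norm_eq] at h5 h6
  simp [List.replicate_succ] at h5 h6
  omega

end nred
end MMP

set_option linter.unusedSectionVars false
set_option linter.unusedVariables false
namespace MMP
open FreeGroup hiding map_mul map_inv map_one

section nex
variable {α : Type} [DecidableEq α]

theorem whEquiv_apply (x : α × Bool) (p q : α → ℤ) (g) : whEquiv x p q g = whHom x p q g := rfl

theorem ne_bar_cases (a b : α × Bool) (h : a ≠ bar b) : a = b ∨ a.1 ≠ b.1 := by
  obtain ⟨i, e⟩ := a
  obtain ⟨j, e'⟩ := b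
  by_cases hij : i = j
  · left; subst hij; cases e <;> cases e' <;> simp_all [bar]
  · right; exact hij

theorem transv (a b : α × Bool) (hab : a.1 ≠ b.1) : ∃ τ : FreeGroup α ≃* FreeGroup α,
    τ (lt a) = lt a * lt b ∧ ∀ j, j ≠ a.1 → τ (of j) = of j := by
  obtain ⟨i, e⟩ := a
  simp only at hab
  cases e
  · refine ⟨whEquiv b (fun j => if j = i then -1 else 0) (fun _ => 0), ?_, ?_⟩
    · rw [lt_false, map_inv]
      rw [whEquiv_apply, whHom, lift_apply_of]; simp [hab]
    · intro j hj
      simp only at hj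
      rw [whEquiv_apply, whHom, lift_apply_of]; simp [hj]
  · refine ⟨whEquiv b (fun _ => 0) (fun j => if j = i then 1 else 0), ?_, ?_⟩
    · rw [lt_true]
      rw [whEquiv_apply, whHom, lift_apply_of]; simp [hab]
    · intro j hj
      simp only at hj
      rw [whEquiv_apply, whHom, lift_apply_of]; simp [hj]

/-- numeral value of a word -/
noncomputable def val [Fintype α] (l : List (α × Bool)) : ℕ :=
  l.foldl (fun s a => s * Fintype.card (α × Bool) + Fintype.equivFin (α × Bool) a) 0

theorem val_concat [Fintype α] (l : List (α × Bool)) (a) : val (l ++ [a]) =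
    val l * Fintype.card (α × Bool) + Fintype.equivFin (α × Bool) a := by
  simp [val, List.foldl_append]

theorem val_inj [Fintype α] (l l' : List (α × Bool)) (h : l.length = l'.length)
    (hv : val l = val l') : l = l' := by
  induction l using List.reverseRecOn generalizing l' with
  | nil => exact (List.length_eq_zero_iff.1 h.symm).symm
  | append_singleton l a ih =>
    cases l' using List.reverseRecOn with
    | nil => simp at h
    | append_singleton l' a' =>
      rw [val_concat, val_concat] at hv
      simp at h
      have h1 := (Fintype.equivFin (α × Bool) a).2
      have h2 := (Fintype.equivFin (α × Bool) a').2
      have hd := congrArg (· / Fintype.card (α × Bool)) hv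
      have hm := congrArg (· % Fintype.card (α × Bool)) hv
      have hpos : 0 < Fintype.card (α × Bool) := by omega
      simp only [Nat.mul_add_mod_self_right, Nat.mod_eq_of_lt h1, Nat.mod_eq_of_lt h2] at hm
      have hd' : val l = val l' := by
        have e1 : ∀ x y : ℕ, y < Fintype.card (α × Bool) →
            (x * Fintype.card (α × Bool) + y) / Fintype.card (α × Bool) = x := by
          intro x y hy
          rw [add_comm, Nat.add_mul_div_right _ _ hpos, Nat.div_eq_of_lt hy, zero_add]
        simp only [e1 _ _ h1, e1 _ _ h2] at hd
        exact hd
      rw [ih l' h hd', (Fintype.equivFin (α × Bool)).injective (Fin.ext hm)]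

theorem val_append_lt [Fintype α] (A A' B : List (α × Bool)) (h : val A < val A') :
    val (A ++ B) < val (A' ++ B) := by
  induction B using List.reverseRecOn with
  | nil => simpa
  | append_singleton B b ih =>
    rw [← List.append_assoc, ← List.append_assoc, val_concat, val_concat]
    have h1 := (Fintype.equivFin (α × Bool) b).2
    have : val (A ++ B) * Fintype.card (α × Bool) < val (A' ++ B) * Fintype.card (α × Bool) :=
      Nat.mul_lt_mul_of_pos_right ih (by omega)
    omega

def half (g : FreeGroup α) : List (α × Bool) := g.toWord.take (g.norm / 2)

noncomputable def wt [Fintype α] (g : FreeGroup α) : ℕ := val (half g) + val (half g⁻¹)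

theorem wt_inv [Fintype α] (g : FreeGroup α) : wt g⁻¹ = wt g := by
  unfold wt; rw [inv_inv, add_comm]

theorem wt_lt [Fintype α] (y z : FreeGroup α) (h1 : 2 * cc y z = y.norm) (h2 : 2 * cc y z ≤ z.norm)
    (hv : val (half y) < val (half y⁻¹)) : wt (y * z) < wt z := by
  obtain ⟨s, q, t, e1, e2, e3⟩ := cancel y z
  have hn := cc_norm y z
  have hq : q.length = cc y z := by
    have hn' := hn
    rw [norm_eq, norm_eq, norm_eq, e1, e2, e3] at hn'
    simp [invRev_length] at hn'; omega
  have hs : s.length = cc y z := by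
    have : y.norm = _ := norm_eq y
    rw [e1] at this; simp [invRev_length] at this; omega
  have hhy : half y = s := by
    unfold half; rw [← h1, e1, ← hs]; simp
  have hhy' : half y⁻¹ = q := by
    unfold half; rw [norm_inv_eq, ← h1, toWord_inv, e1, invRev_append, invRev_invRev, ← hq]; simp
  rw [hhy, hhy'] at hv
  have hyz : (y * z).norm = z.norm := by omega
  set L := z.norm / 2
  have hL : cc y z ≤ L := by omega
  have hz : half z = q ++ t.take (L - cc y z) := by
    unfold half; rw [e2, List.take_append, hq, List.take_of_length_le (by omega)]
  have hyz2 : half (y * z) = s ++ t.take (L - cc y z) := by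
    unfold half; rw [hyz, e3, List.take_append, hs, List.take_of_length_le (by omega)]
  have htl : t.length + cc y z = z.norm := by rw [norm_eq z, e2, ← hq]; simp; omega
  have hzi : half z⁻¹ = half (y * z)⁻¹ := by
    unfold half; rw [norm_inv_eq, norm_inv_eq, hyz, toWord_inv, toWord_inv, e2, e3, invRev_append,
      invRev_append, List.take_append_of_le_length, List.take_append_of_le_length]
    · rw [invRev_length]; omega
    · rw [invRev_length]; omega
  unfold wt
  rw [hzi, hz, hyz2]
  have := val_append_lt _ _ (t.take (L - cc y z)) hv
  omega

theorem sum_change [Fintype α] (p q : α → ℕ) (i : α) (h : ∀ j, j ≠ i → p j = q j)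
    (hs : ∑ j, p j ≤ ∑ j, q j) : p i ≤ q i := by
  rw [← Finset.add_sum_erase _ _ (Finset.mem_univ i),
    ← Finset.add_sum_erase _ _ (Finset.mem_univ i)] at hs
  have : ∑ j ∈ Finset.univ.erase i, p j = ∑ j ∈ Finset.univ.erase i, q j :=
    Finset.sum_congr rfl fun j hj => h j (Finset.ne_of_mem_erase hj)
  omega

theorem sum_change_eq [Fintype α] (p q : α → ℕ) (i : α) (h : ∀ j, j ≠ i → p j = q j)
    (hi : p i = q i) : ∑ j, p j = ∑ j, q j :=
  Finset.sum_congr rfl fun j _ => by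
    by_cases hj : j = i
    · rw [hj, hi]
    · exact h j hj

theorem inv_fun_lt (z : FreeGroup α →* FreeGroup α) (F : FreeGroup α → ℕ)
    (hF : ∀ g, F g⁻¹ = F g) (a : α × Bool) : F (z (of a.1)) = F (z (lt a)) := by
  obtain ⟨i, e⟩ := a
  cases e
  · rw [lt_false, map_inv, hF]
  · rfl

set_option maxHeartbeats 1000000 in
theorem exists_nred [Fintype α] (f : FreeGroup α →* FreeGroup α) (hf : Function.Injective f) :
    ∃ β : FreeGroup α ≃* FreeGroup α, N2 (f.comp β.toMonoidHom) Set.univ ∧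
      ∀ W, FreeGroup.IsReduced W → ∀ x ∈ W,
        (f (β (lt x))).norm ≤ (f (β (mk W))).norm := by
  let P : (FreeGroup α ≃* FreeGroup α) → ℕ := fun β => ∑ i, (f (β (of i))).norm
  let Q : (FreeGroup α ≃* FreeGroup α) → ℕ := fun β => ∑ i, wt (f (β (of i)))
  obtain ⟨β0, -, hβ0⟩ := WellFounded.has_min (measure P).wf Set.univ ⟨MulEquiv.refl _, trivial⟩
  obtain ⟨β, hβP, hβ⟩ := WellFounded.has_min (measure Q).wf {β | P β = P β0} ⟨β0, rfl⟩
  have hP : ∀ γ, P β ≤ P γ := fun γ => by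
    have : P β = P β0 := hβP
    rw [this]; exact not_lt.1 (hβ0 γ trivial)
  have hQ : ∀ γ, P γ = P β → Q β ≤ Q γ := fun γ hγ => not_lt.1 (hβ γ (hγ.trans hβP))
  clear hβ0 hβ hβP
  let z := f.comp β.toMonoidHom
  have hz : ∀ g, z g = f (β g) := fun g => rfl
  have hzinj : ∀ g, z g = 1 → g = 1 := by
    intro g hg
    have : β g = 1 := hf (by rw [map_one]; exact hg)
    simpa using this
  -- consequences of minimality
  have hmin : ∀ a b : α × Bool, a.1 ≠ b.1 → (z (lt a)).norm ≤ (z (lt a) * z (lt b)).norm ∧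
      ((z (lt a) * z (lt b)).norm = (z (lt a)).norm →
        wt (z (lt a)) ≤ wt (z (lt a) * z (lt b))) := by
    intro a b hab
    obtain ⟨τ, hτ, hτ'⟩ := transv a b hab
    have e0 : ∀ j, j ≠ a.1 → f (β (of j)) = f ((τ.trans β) (of j)) := by
      intro j hj; simp [hτ' j hj]
    have e1 : ∀ (F : FreeGroup α → ℕ) (hF : ∀ g, F g⁻¹ = F g),
        F (f ((τ.trans β) (of a.1))) = F (z (lt a) * z (lt b)) := by
      intro F hF
      have := inv_fun_lt (f.comp (τ.trans β).toMonoidHom) F hF a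
      have e2 : (f.comp (τ.trans β).toMonoidHom) (lt a) = z (lt a) * z (lt b) := by
        rw [← map_mul, ← hτ]; rfl
      rw [e2] at this
      exact this
    have e3 : ∀ (F : FreeGroup α → ℕ) (hF : ∀ g, F g⁻¹ = F g),
        F (f (β (of a.1))) = F (z (lt a)) := fun F hF => inv_fun_lt z F hF a
    constructor
    · have := sum_change _ _ a.1 (fun j hj => congrArg FreeGroup.norm (e0 j hj)) (hP (τ.trans β))
      rwa [e1 _ (fun g => norm_inv_eq), e3 _ (fun g => norm_inv_eq)] at this
    · intro he
      have hPe : P (τ.trans β) = P β := by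
        apply sum_change_eq _ _ a.1 (fun j hj => congrArg FreeGroup.norm (e0 j hj).symm)
        rw [e1 _ (fun g => norm_inv_eq), e3 _ (fun g => norm_inv_eq), he]
      have := sum_change _ _ a.1 (fun j hj => congrArg wt (e0 j hj)) (hQ (τ.trans β) hPe)
      rwa [e1 _ (fun g => wt_inv _), e3 _ (fun g => wt_inv _)] at this
  have hne : ∀ a : α × Bool, z (lt a) ≠ 1 := by
    intro a h
    have := congrArg FreeGroup.norm (hzinj _ h)
    rw [norm_lt, FreeGroup.norm_one] at this; omega
  have hcases := ne_bar_cases (α := α)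
  have hN1' : ∀ a b : α × Bool, a ≠ bar b → 2 * cc (z (lt a)) (z (lt b)) ≤ (z (lt b)).norm := by
    intro a b hab
    rcases hcases a b hab with rfl | h
    · exact (sq_norm _ (hne a)).le
    · have h1 := (hmin a b h).1
      have h2 := cc_norm (z (lt a)) (z (lt b))
      omega
  have hccb : ∀ a b : α × Bool, cc (z (lt (bar b))) (z (lt (bar a))) = cc (z (lt a)) (z (lt b)) := by
    intro a b
    rw [lt_bar, lt_bar, map_inv, map_inv, cc_symm]
  have hnb : ∀ a : α × Bool, (z (lt (bar a))).norm = (z (lt a)).norm := by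
    intro a; rw [lt_bar, map_inv, norm_inv_eq]
  have hN1 : ∀ a b : α × Bool, a ≠ bar b → 2 * cc (z (lt a)) (z (lt b)) ≤ (z (lt a)).norm := by
    intro a b hab
    have := hN1' (bar b) (bar a) (by rw [Ne, bar_inj]; rintro rfl; simp at hab)
    rwa [hccb, hnb] at this
  have hval : ∀ b c : α × Bool, b ≠ bar c → b ≠ c → 2 * cc (z (lt b)) (z (lt c)) = (z (lt b)).norm →
      ¬ val (half (z (lt b))) < val (half (z (lt b))⁻¹) := by
    intro b c hbc hbc' he hv
    have h1 := wt_lt (z (lt b)) (z (lt c)) he (hN1' b c hbc) hv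
    have hne' : (bar c).1 ≠ (bar b).1 := by
      rcases hcases b c hbc with h | h
      · exact absurd h hbc'
      · exact Ne.symm h
    have h2 := (hmin (bar c) (bar b) hne').2
    have e : z (lt (bar c)) * z (lt (bar b)) = (z (lt b) * z (lt c))⁻¹ := by
      rw [lt_bar, lt_bar, map_inv, map_inv]; group
    rw [e, norm_inv_eq, wt_inv, hnb, lt_bar c, map_inv, wt_inv] at h2
    have h3 := h2 (by have := cc_norm (z (lt b)) (z (lt c)); omega)
    omega
  have hN2 : N2 z Set.univ := by
    intro a b c _ _ _ hab hbc
    by_contra hlt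
    have h1 := hN1' a b hab
    have h2 := hN1 b c hbc
    have h3 : 2 * cc (z (lt a)) (z (lt b)) = (z (lt b)).norm := by omega
    have h4 : 2 * cc (z (lt b)) (z (lt c)) = (z (lt b)).norm := by omega
    have hab' : a ≠ b := by
      rintro rfl
      have := sq_norm _ (hne a); omega
    have hbc' : b ≠ c := by
      rintro rfl
      have := sq_norm _ (hne b); omega
    have v1 := hval b c hbc hbc' h4
    have v2 := hval (bar b) (bar a) (by rw [bar_bar]; rintro rfl; exact hab rfl |>.elim)
      (by rw [Ne, bar_inj]; exact hab'.symm) (by rw [hccb, hnb]; exact h3)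
    rw [lt_bar, map_inv, inv_inv] at v2
    have hvv : val (half (z (lt b))) = val (half (z (lt b))⁻¹) := by omega
    have heven : Even (z (lt b)).norm := by rw [← h4]; exact even_two_mul _
    have hh := val_inj _ _ (by simp [half, ← norm_eq, norm_inv_eq]) hvv
    apply hne b
    obtain ⟨m, hm⟩ := heven
    have hlen : (z (lt b)).toWord.length = m + m := hm
    have e1 : (z (lt b))⁻¹.toWord.take m = invRev ((z (lt b)).toWord.drop m) := by
      rw [toWord_inv]
      conv_lhs => rw [← List.take_append_drop m (z (lt b)).toWord, invRev_append]
      rw [List.take_append_of_le_length (by rw [invRev_length, List.length_drop]; omega),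
        List.take_of_length_le (by rw [invRev_length, List.length_drop]; omega)]
    have hm2 : (m + m) / 2 = m := by omega
    unfold half at hh
    rw [norm_inv_eq, hm, hm2, e1] at hh
    rw [← mk_toWord (x := z (lt b)), ← List.take_append_drop m (z (lt b)).toWord, hh, mk_append,
      ← inv_mk, inv_mul_cancel]
  exact ⟨β, hN2, fun W hW x hx => glob4 hN2 hN1' hN1 W hW x hx⟩

end nex
end MMP

set_option linter.unusedSectionVars false
set_option linter.unusedVariables false
namespace MMP
open FreeGroup hiding map_mul map_inv map_one

section ext
variable {α : Type} [DecidableEq α] [Fintype α]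

def lam (c : α → ℤ) (g : FreeGroup α) : ℤ := ∑ y, Multiplicative.toAdd (expo y g) * c y

theorem lam_mul (c : α → ℤ) (g h : FreeGroup α) : lam c (g * h) = lam c g + lam c h := by
  simp [lam, add_mul, Finset.sum_add_distrib]

theorem lam_one (c : α → ℤ) : lam c 1 = 0 := by simp [lam]

theorem lam_inv (c : α → ℤ) (g : FreeGroup α) : lam c g⁻¹ = - lam c g := by
  simp [lam]

theorem lam_pow (c : α → ℤ) (g : FreeGroup α) (k : ℕ) : lam c (g ^ k) = k * lam c g := by
  induction k with
  | zero => simp [lam_one]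
  | succ k ih => rw [pow_succ, lam_mul, ih]; push_cast; ring

theorem lam_of (c : α → ℤ) (i : α) : lam c (of i) = c i := by
  simp [lam, expo]

theorem exists_lam (z : FreeGroup α →* FreeGroup α) (S : Set α) (j : α) (hj : j ∉ S) :
    ∃ (c : α → ℤ) (i : α), c i ≠ 0 ∧ ∀ s ∈ S, lam c (z (of s)) = 0 := by
  classical
  let M : Matrix α α ℤ := fun s y => if s ∈ S then Multiplicative.toAdd (expo y (z (of s))) else 0
  have hd : M.det = 0 := Matrix.det_eq_zero_of_row_eq_zero j (fun y => by simp [M, hj])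
  obtain ⟨c, hc, hM⟩ := Matrix.exists_mulVec_eq_zero_iff.2 hd
  obtain ⟨i, hi⟩ := Function.ne_iff.1 hc
  refine ⟨c, i, hi, fun s hs => ?_⟩
  have := congrFun hM s
  simpa [M, Matrix.mulVec, dotProduct, hs, lam] using this

/-- subgroup with bounded heights of prefixes -/
def GC (c : α → ℤ) (C : ℕ) : Subgroup (FreeGroup α) where
  carrier := {g | lam c g = 0 ∧ ∀ v, v <+: g.toWord → |lam c (mk v)| ≤ C}
  one_mem' := by
    refine ⟨lam_one c, fun v hv => ?_⟩
    have : v = [] := by simpa using hv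
    subst this
    change |lam c 1| ≤ _
    rw [lam_one]; simp
  mul_mem' := by
    rintro g h ⟨hg, hg'⟩ ⟨hh, hh'⟩
    refine ⟨by rw [lam_mul, hg, hh, add_zero], fun v hv => ?_⟩
    obtain ⟨s, q, t, e1, e2, e3⟩ := cancel g h
    rw [e3] at hv
    have hv2 : v <+: s ∨ ∃ t', v = s ++ t' ∧ t' <+: t := by
      rcases List.prefix_or_prefix_of_prefix hv (List.prefix_append s t) with h | ⟨t', h⟩
      · exact Or.inl h
      · refine Or.inr ⟨t', h.symm, ?_⟩
        rw [← h] at hv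
        exact (List.prefix_append_right_inj s).1 hv
    rcases hv2 with hv | ⟨t', rfl, ht'⟩
    · apply hg'; rw [e1]; exact hv.trans (List.prefix_append _ _)
    · have h1 : lam c (mk s) = lam c (mk q) := by
        have : lam c (mk (s ++ invRev q)) = 0 := by rw [← e1, mk_toWord, hg]
        rw [mk_append, ← inv_mk, lam_mul, lam_inv] at this; omega
      have h2 := hh' (q ++ t') (by rw [e2]; exact (List.prefix_append_right_inj _).2 ht')
      rw [mk_append, lam_mul] at h2 ⊢
      rw [h1]; exact h2
  inv_mem' := by
    rintro g ⟨hg, hg'⟩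
    refine ⟨by rw [lam_inv, hg, neg_zero], fun v hv => ?_⟩
    obtain ⟨w, hw⟩ := hv
    have e : g.toWord = invRev w ++ invRev v := by
      rw [← invRev_append, hw, toWord_inv, invRev_invRev]
    have h1 := hg' (invRev w) (by rw [e]; exact List.prefix_append _ _)
    have h2 : lam c (mk (v ++ w)) = 0 := by rw [hw, mk_toWord, lam_inv, hg, neg_zero]
    rw [mk_append, lam_mul] at h2
    rw [← inv_mk, lam_inv, abs_neg] at h1
    have : lam c (mk v) = - lam c (mk w) := by omega
    rw [this, abs_neg]; exact h1

theorem mem_GC (c : α → ℤ) (g : FreeGroup α) (h : lam c g = 0) : ∃ C0, ∀ C ≥ C0, g ∈ GC c C := by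
  refine ⟨∑ v ∈ g.toWord.inits.toFinset, (lam c (mk v)).natAbs, fun C hC => ⟨h, fun v hv => ?_⟩⟩
  have : (lam c (mk v)).natAbs ≤ ∑ v ∈ g.toWord.inits.toFinset, (lam c (mk v)).natAbs :=
    Finset.single_le_sum (f := fun v => (lam c (mk v)).natAbs) (fun _ _ => Nat.zero_le _)
      (by simpa using hv)
  rw [Int.abs_eq_natAbs]; exact_mod_cast this.trans hC

theorem exists_GC (c : α → ℤ) (z : FreeGroup α →* FreeGroup α) (S : Set α)
    (h : ∀ s ∈ S, lam c (z (of s)) = 0) : ∃ C, ∀ s ∈ S, z (of s) ∈ GC c C := by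
  classical
  have : ∀ s, ∃ C0, s ∈ S → ∀ C ≥ C0, z (of s) ∈ GC c C := by
    intro s
    by_cases hs : s ∈ S
    · obtain ⟨C0, hC⟩ := mem_GC c _ (h s hs)
      exact ⟨C0, fun _ => hC⟩
    · exact ⟨0, fun h => absurd h hs⟩
  choose C0 hC0 using this
  exact ⟨∑ s, C0 s, fun s hs => hC0 s hs _
    (Finset.single_le_sum (f := C0) (fun _ _ => Nat.zero_le _) (Finset.mem_univ s))⟩

theorem conj_head (c : α → ℤ) (C : ℕ) (x : α × Bool) (hx : lam c (lt x) ≠ 0) (B : FreeGroup α)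
    (hB : B ∈ GC c C) (hB1 : B ≠ 1) :
    ((lt x ^ (C + 1))⁻¹ * B * lt x ^ (C + 1)).toWord.head? = some (bar x) := by
  set p := lt x ^ (C + 1) with hp
  have hpw : p.toWord = List.replicate (C+1) x := toWord_lt_pow _ _
  have hpi : p⁻¹.toWord = List.replicate (C+1) (bar x) := by
    rw [hp, ← inv_pow, ← lt_bar, toWord_lt_pow]
  obtain ⟨s, q, t, e1, e2, e3⟩ := cancel p⁻¹ B
  have hq : q = List.replicate q.length x := by
    rw [List.eq_replicate_iff]
    refine ⟨rfl, fun b hb => ?_⟩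
    have : bar b ∈ p⁻¹.toWord := by
      rw [e1, invRev_eq]; simp only [List.mem_append, List.mem_reverse, List.mem_map]
      exact Or.inr ⟨b, hb, rfl⟩
    rw [hpi] at this
    exact bar_inj.1 (List.eq_of_mem_replicate this)
  have hql : q.length ≤ C := by
    have h1 := hB.2 q (by rw [e2]; exact List.prefix_append _ _)
    rw [hq, ← lt_pow, lam_pow, abs_mul, Nat.abs_cast] at h1
    have : 1 ≤ |lam c (lt x)| := Int.one_le_abs hx
    have : (q.length : ℤ) ≤ C := by nlinarith
    exact_mod_cast this
  have hs : s.head? = some (bar x) := by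
    have hl := congrArg List.length (hpi.symm.trans e1)
    simp [invRev_length] at hl
    cases s with
    | nil => simp at hl; omega
    | cons b s =>
      have : b ∈ p⁻¹.toWord := by rw [e1]; simp
      rw [hpi] at this
      rw [List.eq_of_mem_replicate this]; rfl
  have hh : (p⁻¹ * B).toWord.head? = some (bar x) := by
    rw [e3, List.head?_append, hs]; rfl
  obtain ⟨s', q', t', e1', e2', e3'⟩ := cancel (p⁻¹ * B) p
  cases s' with
  | cons b s' => rw [e3', ← hh, e1']; rfl
  | nil =>
    exfalso
    have ht : t' = List.replicate t'.length x := by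
      rw [List.eq_replicate_iff]
      refine ⟨rfl, fun b hb => ?_⟩
      have : b ∈ p.toWord := by rw [e2']; simp [hb]
      rw [hpw] at this
      exact List.eq_of_mem_replicate this
    have hg : p⁻¹ * B * p = lt x ^ t'.length := by
      rw [lt_pow, ← ht, ← mk_toWord (x := p⁻¹ * B * p), e3']; rfl
    have hl := congrArg (lam c) hg
    rw [lam_mul, lam_mul, lam_inv, hB.1, lam_pow c (lt x) t'.length] at hl
    have : (t'.length : ℤ) * lam c (lt x) = 0 := by rw [← hl]; ring
    have h0 : t'.length = 0 := by
      rcases mul_eq_zero.1 this with h | h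
      · exact_mod_cast h
      · exact absurd h hx
    rw [h0, pow_zero] at hg
    apply hB1
    have : B = p * (p⁻¹ * B * p) * p⁻¹ := by group
    rw [this, hg]; group

theorem toWord_mul_red (g h : FreeGroup α)
    (hgh : ∀ a ∈ g.toWord.getLast?, ∀ b ∈ h.toWord.head?, b ≠ bar a) :
    (g * h).toWord = g.toWord ++ h.toWord := by
  have : g * h = mk (g.toWord ++ h.toWord) := by rw [mk_append, mk_toWord, mk_toWord]
  rw [this, toWord_mk_red]
  exact red_append.2 ⟨isReduced_toWord, isReduced_toWord, hgh⟩

/-- injectivity on the subgroup generated by some letters -/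
def InjS (z : FreeGroup α →* FreeGroup α) (S : Set α) : Prop :=
  ∀ g, (∀ l ∈ g.toWord, l.1 ∈ S) → z g = 1 → g = 1

theorem ext_one (hα : Nontrivial α) (z : FreeGroup α →* FreeGroup α) (S : Set α) (hz : InjS z S)
    (j : α) (hj : j ∉ S) :
    ∃ z' : FreeGroup α →* FreeGroup α, (∀ s ∈ S, z' (of s) = z (of s)) ∧ InjS z' (insert j S) := by
  obtain ⟨c, i, hci, hc⟩ := exists_lam z S j hj
  obtain ⟨C, hC⟩ := exists_GC c z S hc
  obtain ⟨y, hy⟩ := exists_ne i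
  set x : α × Bool := (i, true) with hxdef
  have hx : lam c (lt x) ≠ 0 := by rw [hxdef, lt_true, lam_of]; exact hci
  set p := lt x ^ (C + 1) with hp
  let ph : FreeGroup α →* FreeGroup α :=
    lift (fun k => if k = j then of y else p⁻¹ * z (of k) * p)
  have phj : ∀ e, ph (lt (j, e)) = lt (y, e) := by
    intro e
    cases e
    · rw [lt_false, lt_false, map_inv]; simp [ph]
    · rw [lt_true, lt_true]; simp [ph]
  have phS : ∀ l : α × Bool, l.1 ≠ j → ph (lt l) = p⁻¹ * z (lt l) * p := by
    rintro ⟨k, e⟩ hk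
    simp only at hk
    cases e
    · rw [lt_false, map_inv, map_inv]; simp [ph, hk, mul_assoc]
    · rw [lt_true]; simp [ph, hk]
  have phV : ∀ V : List (α × Bool), (∀ l ∈ V, l.1 ≠ j) → ph (mk V) = p⁻¹ * z (mk V) * p := by
    intro V hV
    induction V with
    | nil => have : (mk ([] : List (α × Bool))) = 1 := rfl
             rw [this, map_one, map_one]; group
    | cons a V ih =>
      rw [mk_cons, map_mul, map_mul, ih (fun l hl => hV l (by simp [hl])), phS a (hV a (by simp))]
      group
  have hzl : ∀ l : α × Bool, l.1 ∈ S → z (lt l) ∈ GC c C := by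
    rintro ⟨k, e⟩ hk
    cases e
    · rw [lt_false, map_inv]; exact inv_mem (hC k hk)
    · exact hC k hk
  have hzV : ∀ V : List (α × Bool), (∀ l ∈ V, l.1 ∈ S) → z (mk V) ∈ GC c C := by
    intro V hV
    induction V with
    | nil => have : (mk ([] : List (α × Bool))) = 1 := rfl
             rw [this, map_one]; exact one_mem _
    | cons a V ih =>
      rw [mk_cons, map_mul]
      exact mul_mem (hzl a (hV a (by simp))) (ih (fun l hl => hV l (by simp [hl])))
  have hSj : ∀ k ∈ S, k ≠ j := fun k hk h => hj (h ▸ hk)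
  -- main claim
  have main : ∀ (N : ℕ) (a : α × Bool) (W : List (α × Bool)), W.length = N →
      FreeGroup.IsReduced (a :: W) → (∀ l ∈ a :: W, l.1 = j ∨ l.1 ∈ S) →
      ((a.1 = j → (ph (mk (a :: W))).toWord.head? = some (y, a.2)) ∧
       (a.1 ∈ S → (ph (mk (a :: W))).toWord.head? = some (bar x))) := by
    intro N
    induction N using Nat.strong_induction_on with
    | _ N ih =>
    intro a W hWN hr hS
    have hr' := red_cons.1 hr
    constructor
    · intro haj
      obtain ⟨a1, e⟩ := a
      simp only at haj; subst haj
      rw [mk_cons, map_mul, phj, toWord_mul_red]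
      · rw [toWord_lt]; rfl
      · intro a' ha' b hb
        rw [toWord_lt] at ha'
        simp at ha'; subst ha'
        cases W with
        | nil =>
          have : (mk ([] : List (α × Bool))) = 1 := rfl
          rw [this, map_one] at hb; simp at hb
        | cons d W =>
          have hd := ih W.length (by simp at hWN; omega) d W rfl hr'.1
            (fun l hl => hS l (by simp [hl]))
          rcases hS d (by simp) with h | h
          · have h1 := hd.1 h
            rw [h1] at hb; simp at hb; subst hb
            have h2 := hr'.2 d (by simp)
            obtain ⟨d1, d2⟩ := d
            simp only at h; subst h
            simpa [bar] using h2
          · have h1 := hd.2 h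
            rw [h1] at hb; simp at hb; subst hb
            simp [bar, hxdef]
            intro h; exact absurd h.symm hy
    · intro haS
      set V := (a :: W).takeWhile (fun l => decide (l.1 ≠ j)) with hV
      set W' := (a :: W).dropWhile (fun l => decide (l.1 ≠ j)) with hW'
      have hVW : V ++ W' = a :: W := List.takeWhile_append_dropWhile
      have hVj : ∀ l ∈ V, l.1 ≠ j := by
        intro l hl
        have := List.mem_takeWhile_imp hl
        simpa using this
      have hVS : ∀ l ∈ V, l.1 ∈ S := by
        intro l hl
        rcases hS l (by rw [← hVW]; simp [hl]) with h | h
        · exact absurd h (hVj l hl)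
        · exact h
      have hVne : V ≠ [] := by
        rw [hV, List.takeWhile_cons]; simp [hSj _ haS]
      have hVr : FreeGroup.IsReduced V := by rw [← hVW] at hr; exact red_left hr
      have hW'r : FreeGroup.IsReduced W' := by rw [← hVW] at hr; exact red_right hr
      have hzne : z (mk V) ≠ 1 := by
        intro h
        have := hz (mk V) (by rw [toWord_mk_red hVr]; exact hVS) h
        have h2 := congrArg toWord this
        rw [toWord_mk_red hVr] at h2
        exact hVne (by simpa using h2)
      have hh1 : (ph (mk V)).toWord.head? = some (bar x) := by
        rw [phV V hVj]; exact conj_head c C x hx _ (hzV V hVS) hzne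
      have hh2 : (ph (mk V)).toWord.getLast? = some x := by
        have h1 : ((ph (mk V))⁻¹).toWord.head? = some (bar x) := by
          rw [phV V hVj]
          have := conj_head c C x hx _ (inv_mem (hzV V hVS)) (by simpa using hzne)
          have e : (p⁻¹ * z (mk V) * p)⁻¹ = p⁻¹ * (z (mk V))⁻¹ * p := by
            simp [mul_assoc]
          rw [e]; exact this
        rw [toWord_inv, invRev_eq, List.head?_reverse, List.getLast?_map,
          Option.map_eq_some_iff] at h1
        obtain ⟨b, hb, hbx⟩ := h1
        rw [hb, bar_inj.1 hbx]
      rw [← hVW, mk_append, map_mul, toWord_mul_red]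
      · rw [List.head?_append, hh1]; rfl
      · intro a' ha' b hb
        rw [hh2] at ha'; simp at ha'; subst ha'
        cases hW'c : W' with
        | nil =>
          have : (mk ([] : List (α × Bool))) = 1 := rfl
          rw [hW'c, this, map_one] at hb; simp at hb
        | cons d W1 =>
          have hdj : d.1 = j := by
            have := List.head?_dropWhile_not (fun l : α × Bool => decide (l.1 ≠ j)) (a :: W)
            rw [← hW', hW'c] at this
            simpa using this
          have hlen := congrArg List.length hVW
          have hVl := List.length_pos_iff.2 hVne
          rw [hW'c] at hlen hW'r
          simp at hlen
          have hd := ih W1.length (by omega) d W1 rfl hW'r (fun l hl => hS l (by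
            rw [← hVW, hW'c]; exact List.mem_append_right _ hl))
          have h1 := hd.1 hdj
          rw [hW'c, h1] at hb
          simp at hb; subst hb
          simp [bar, hxdef]
          intro h; exact absurd h hy
  refine ⟨(MulAut.conj p).toMonoidHom.comp ph, ?_, ?_⟩
  · intro s hs
    have := phS (s, true) (hSj s hs)
    rw [lt_true] at this
    simp only [MonoidHom.comp_apply, this]
    simp [mul_assoc]
  · intro g hg hg1
    have h1 : ph g = 1 := by simpa using hg1
    by_contra hne
    cases hw : g.toWord with
    | nil => exact hne (toWord_eq_nil_iff.1 hw)
    | cons a W =>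
      have hr : FreeGroup.IsReduced (a :: W) := by rw [← hw]; exact isReduced_toWord
      have hS : ∀ l ∈ a :: W, l.1 = j ∨ l.1 ∈ S := by
        intro l hl; rw [← hw] at hl; simpa using hg l hl
      have hm := main _ a W rfl hr hS
      rw [← hw, mk_toWord, h1] at hm
      rcases hS a (by simp) with h | h
      · have := hm.1 h; simp at this
      · have := hm.2 h; simp at this

theorem ext_all (hα : Nontrivial α) (z : FreeGroup α →* FreeGroup α) (S : Set α) (hz : InjS z S) :
    ∃ z' : FreeGroup α →* FreeGroup α, (∀ s ∈ S, z' (of s) = z (of s)) ∧ Function.Injective z' := by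
  have : ∀ T : Finset α, ∃ z' : FreeGroup α →* FreeGroup α,
      (∀ s ∈ S, z' (of s) = z (of s)) ∧ InjS z' (S ∪ T) := by
    intro T
    induction T using Finset.induction_on with
    | empty => exact ⟨z, fun _ _ => rfl, by simpa using hz⟩
    | insert j T hj ih =>
      obtain ⟨z1, h1, h2⟩ := ih
      have e : S ∪ ((insert j T : Finset α) : Set α) = insert j (S ∪ T) := by
        ext; simp
      rw [e]
      by_cases hjS : j ∈ S ∪ (T : Set α)
      · rw [Set.insert_eq_of_mem hjS]; exact ⟨z1, h1, h2⟩
      · obtain ⟨z2, h3, h4⟩ := ext_one hα z1 _ h2 j hjS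
        exact ⟨z2, fun s hs => (h3 s (Or.inl hs)).trans (h1 s hs), h4⟩
  obtain ⟨z', h1, h2⟩ := this Finset.univ
  exact ⟨z', h1, (injective_iff_map_eq_one z').2 fun g hg => h2 g (by simp) hg⟩

end ext
end MMP

set_option linter.unusedSectionVars false
set_option linter.unusedVariables false
namespace MMP
section search
open Primrec
variable {A σ : Type} [Primcodable A] [Primcodable σ]

open scoped Classical in
/-- breadth first search, k-th stage -/
noncomputable def stage (init : A → σ) (next : σ → List σ) (ok : A → σ → Prop) (a : A) (k : ℕ) :
    List σ :=
  Nat.rec [init a] (fun _ s => s ++ (s.flatMap next).filter (fun t => decide (ok a t))) k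

theorem stage_primrec (init : A → σ) (next : σ → List σ) (ok : A → σ → Prop)
    (hi : Primrec init) (hn : Primrec next) (hok : PrimrecRel ok) :
    Primrec₂ (stage init next ok) := by
  classical
  have hok' : PrimrecRel (fun t a => ok a t) := PrimrecRel.comp₂ hok Primrec₂.right Primrec₂.left
  have hf := PrimrecRel.listFilter hok'
  have h1 : Primrec₂ (fun (a : A) (p : ℕ × List σ) =>
      p.2 ++ (p.2.flatMap next).filter (fun t => decide (ok a t))) := by
    refine Primrec₂.mk ?_
    have h2 : Primrec (fun p : A × (ℕ × List σ) => p.2.2.flatMap next) :=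
      list_flatMap (snd.comp snd) (hn.comp snd)
    exact list_append.comp (snd.comp snd) (hf.comp h2 fst)
  have h0 : Primrec (fun a : A => [init a]) := list_cons.comp hi (const [])
  exact nat_rec h0 h1

theorem search (init : A → σ) (next : σ → List σ) (ok : A → σ → Prop) (goal : σ → Prop)
    (hi : Primrec init) (hn : Primrec next) (hok : PrimrecRel ok) (hg : PrimrecPred goal)
    (hfin : ∀ a, {s | ok a s}.Finite) :
    ∃ d : A → Bool, Computable d ∧ ∀ a, d a = true ↔
      ∃ s, Relation.ReflTransGen (fun s t => t ∈ next s ∧ ok a t) (init a) s ∧ goal s := by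
  classical
  have hst := stage_primrec init next ok hi hn hok
  have succ : ∀ a k, stage init next ok a (k+1) = stage init next ok a k ++
      ((stage init next ok a k).flatMap next).filter (fun t => decide (ok a t)) := fun _ _ => rfl
  generalize hS : stage init next ok = S at *
  have S0 : ∀ a, S a 0 = [init a] := by intro a; rw [← hS]; rfl
  have reach : ∀ a k, ∀ s ∈ S a k,
      Relation.ReflTransGen (fun s t => t ∈ next s ∧ ok a t) (init a) s := by
    intro a k
    induction k with
    | zero => intro s hs; rw [S0] at hs; simp at hs; subst hs; exact .refl
    | succ k ih =>
      intro s hs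
      rw [succ] at hs
      simp only [List.mem_append, List.mem_filter, List.mem_flatMap, decide_eq_true_eq] at hs
      rcases hs with hs | ⟨⟨t, ht, hst⟩, hs⟩
      · exact ih s hs
      · exact (ih t ht).tail ⟨hst, hs⟩
  have mono : ∀ a k, S a k ⊆ S a (k+1) := by
    intro a k; rw [succ]; exact List.subset_append_left _ _
  have ex : ∀ a, ∃ k, ∀ t ∈ S a (k+1), t ∈ S a k := by
    intro a
    by_contra hcon
    push Not at hcon
    have hF : (insert (init a) {s | ok a s}).Finite := (hfin a).insert _
    have hsub : ∀ k, ((S a k).toFinset) ⊆ hF.toFinset := by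
      intro k s hs
      have := reach a k s (by simpa using hs)
      rw [Set.Finite.mem_toFinset]
      rcases Relation.ReflTransGen.cases_tail this with h | ⟨t, _, h⟩
      · left; exact h
      · right; exact h.2
    have hcard : ∀ k, k ≤ (S a k).toFinset.card := by
      intro k
      induction k with
      | zero => simp
      | succ k ih =>
        obtain ⟨t, ht, ht'⟩ := hcon k
        have : (S a k).toFinset ⊂ (S a (k+1)).toFinset := by
          refine ⟨fun s hs => ?_, fun h => ?_⟩
          · simp only [List.mem_toFinset] at hs ⊢; exact mono a k hs
          · exact ht' (by simpa using h (show t ∈ (S a (k+1)).toFinset by simpa using ht))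
        have := Finset.card_lt_card this
        omega
    have h1 := hcard (hF.toFinset.card + 1)
    have h2 := Finset.card_le_card (hsub (hF.toFinset.card + 1))
    omega
  have hP : PrimrecPred (fun p : A × ℕ => ∀ t ∈ S p.1 (p.2+1), t ∈ S p.1 p.2) := by
    have hmem : PrimrecRel (fun (t : σ) (l : List σ) => t ∈ l) := by
      have h1 : PrimrecRel (fun (l : List σ) (t : σ) => ∃ a ∈ l, a = t) :=
        PrimrecRel.exists_mem_list Primrec.eq
      refine (PrimrecRel.comp₂ h1 Primrec₂.right Primrec₂.left).of_eq (by simp)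
    exact (PrimrecRel.forall_mem_list hmem).comp (hst.comp fst (Primrec.succ.comp snd)) (hst.comp fst snd)
  have hc : ComputablePred (fun p : A × ℕ => ∀ t ∈ S p.1 (p.2+1), t ∈ S p.1 p.2) := by
    obtain ⟨i, h⟩ := hP
    exact ⟨i, h.to_comp⟩
  have hfind := Computable.find (P := fun a k => ∀ t ∈ S a (k+1), t ∈ S a k) hc ex
  have hgl : PrimrecPred (fun l : List σ => ∃ s ∈ l, goal s) := hg.exists_mem_list
  refine ⟨fun a => decide (∃ s ∈ S a (Nat.find (ex a)), goal s), ?_, ?_⟩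
  · exact hgl.decide.to_comp.comp (hst.to_comp.comp Computable.id hfind)
  · intro a
    rw [decide_eq_true_eq]
    have hsp := Nat.find_spec (ex a)
    generalize Nat.find (ex a) = k at hsp
    constructor
    · rintro ⟨s, hs, hgs⟩
      exact ⟨s, reach a k s hs, hgs⟩
    · rintro ⟨s, hs, hgs⟩
      refine ⟨s, ?_, hgs⟩
      clear hgs
      induction hs with
      | refl =>
        have : ∀ k, init a ∈ S a k := by
          intro k
          induction k with
          | zero => rw [S0]; simp
          | succ k ih => exact mono a k ih
        exact this k
      | tail _ hst ih =>
        apply hsp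
        rw [succ]
        simp only [List.mem_append, List.mem_filter, List.mem_flatMap, decide_eq_true_eq]
        exact Or.inr ⟨⟨_, ih, hst.1⟩, hst.2⟩
end search
end MMP

set_option linter.unusedSectionVars false
set_option linter.unusedVariables false
namespace MMP
section comp
open Primrec
variable {n : ℕ}

theorem reduce_primrec : Primrec (FreeGroup.reduce : List (Fin n × Bool) → List (Fin n × Bool)) := by
  have hstep : Primrec₂ (fun (_ : List (Fin n × Bool)) (p : (Fin n × Bool) × List (Fin n × Bool)) =>
      (List.casesOn p.2 [p.1] fun hd tl =>
        if p.1.1 = hd.1 ∧ p.1.2 = not hd.2 then tl else p.1 :: hd :: tl : List (Fin n × Bool))) := by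
    refine Primrec₂.mk ?_
    have h0 : Primrec (fun q : List (Fin n × Bool) × ((Fin n × Bool) × List (Fin n × Bool)) =>
      [q.2.1]) := list_cons.comp (fst.comp snd) (const [])
    have h1 : Primrec₂ (fun (q : List (Fin n × Bool) × ((Fin n × Bool) × List (Fin n × Bool)))
        (r : (Fin n × Bool) × List (Fin n × Bool)) =>
        if q.2.1.1 = r.1.1 ∧ q.2.1.2 = not r.1.2 then r.2 else q.2.1 :: r.1 :: r.2) := by
      refine Primrec₂.mk (Primrec.ite (PrimrecPred.and ?_ ?_) ?_ ?_)
      · exact Primrec.eq.comp (fst.comp (fst.comp (snd.comp fst))) (fst.comp (fst.comp snd))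
      · exact Primrec.eq.comp (snd.comp (fst.comp (snd.comp fst)))
          (Primrec.not.comp (snd.comp (fst.comp snd)))
      · exact snd.comp snd
      · exact list_cons.comp (fst.comp (snd.comp fst)) (list_cons.comp (fst.comp snd) (snd.comp snd))
    exact list_casesOn (snd.comp snd) h0 h1
  refine (list_foldr Primrec.id (const []) hstep).of_eq fun w => ?_
  induction w with
  | nil => rfl
  | cons a w ih => 
    rw [FreeGroup.reduce.cons, ← ih]; rfl

theorem invRev_primrec : Primrec (FreeGroup.invRev : List (Fin n × Bool) → List (Fin n × Bool)) := by
  refine list_reverse.comp (list_map Primrec.id (Primrec₂.mk ?_))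
  exact pair (fst.comp snd) (Primrec.not.comp (snd.comp snd))

/-- substitution -/
def sub (h : Fin n → List (Fin n × Bool)) (w : List (Fin n × Bool)) : List (Fin n × Bool) :=
  w.flatMap fun l => if l.2 = true then h l.1 else FreeGroup.invRev (h l.1)

theorem app_primrec {β : Type} [Primcodable β] {f : β → Fin n → List (Fin n × Bool)} {g : β → Fin n}
    (hf : Primrec f) (hg : Primrec g) : Primrec (fun b => f b (g b)) :=
  fin_app.comp hf hg

theorem sub_primrec : Primrec₂ (sub : (Fin n → List (Fin n × Bool)) → _ → _) := by
  refine Primrec₂.mk (list_flatMap snd (Primrec₂.mk (Primrec.ite ?_ ?_ ?_)))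
  · exact Primrec.eq.comp (snd.comp snd) (const true)
  · exact app_primrec (fst.comp fst) (fst.comp snd)
  · exact invRev_primrec.comp (app_primrec (fst.comp fst) (fst.comp snd))

abbrev Inp (n : ℕ) := List (List (Fin n × Bool) × List (Fin n × Bool))
abbrev Sta (n : ℕ) := Inp n × (Fin n → List (Fin n × Bool))

/-- bound -/
def bnd (L : Inp n) : ℕ := L.foldr (fun p s => p.1.length + p.2.length + 1 + s) 0

theorem bnd_primrec : Primrec (bnd : Inp n → ℕ) := by
  refine list_foldr Primrec.id (const 0) (h := fun (_ : Inp n) (q : (List (Fin n × Bool) × List (Fin n × Bool)) × ℕ) =>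
      q.1.1.length + q.1.2.length + 1 + q.2)
    (Primrec₂.mk ?_)
  refine nat_add.comp (Primrec.succ.comp (nat_add.comp ?_ ?_)) (snd.comp snd)
  · exact list_length.comp (fst.comp (fst.comp snd))
  · exact list_length.comp (snd.comp (fst.comp snd))

def ok (L : Inp n) (s : Sta n) : Prop :=
  s.1.length ≤ bnd L ∧ (∀ p ∈ s.1, p.1.length ≤ bnd L ∧ p.2.length ≤ bnd L) ∧
    ∀ i, (s.2 i).length ≤ bnd L

theorem ok_primrec : PrimrecRel (ok : Inp n → Sta n → Prop) := by
  have h1 : PrimrecRel (fun (p : List (Fin n × Bool) × List (Fin n × Bool)) (N : ℕ) =>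
      p.1.length ≤ N ∧ p.2.length ≤ N) :=
    PrimrecPred.and (nat_le.comp (list_length.comp (fst.comp fst)) snd)
      (nat_le.comp (list_length.comp (snd.comp fst)) snd)
  have h2 : PrimrecRel (fun (i : Fin n) (q : (Fin n → List (Fin n × Bool)) × ℕ) =>
      (q.1 i).length ≤ q.2) :=
    nat_le.comp (list_length.comp (app_primrec (fst.comp snd) fst)) (snd.comp snd)
  refine PrimrecPred.and ?_ (PrimrecPred.and ?_ ?_)
  · exact nat_le.comp (list_length.comp (fst.comp snd)) (bnd_primrec.comp fst)
  · exact (PrimrecRel.forall_mem_list h1).comp (fst.comp snd) (bnd_primrec.comp fst)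
  · refine ((PrimrecRel.forall_mem_list h2).comp (const (List.finRange n))
      (pair (snd.comp snd) (bnd_primrec.comp fst))).of_eq (fun p => ?_)
    simp

theorem list_finite {β : Type} (F : Set β) (hF : F.Finite) (N : ℕ) :
    {T : List β | T.length ≤ N ∧ ∀ p ∈ T, p ∈ F}.Finite := by
  have : Finite F := hF
  refine ((List.finite_length_le F N).image (List.map Subtype.val)).subset ?_
  rintro T ⟨h1, h2⟩
  refine ⟨T.attach.map (fun x => ⟨x.1, h2 x.1 x.2⟩), by simpa using h1, ?_⟩
  simp [List.map_map, Function.comp_def]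

theorem ok_finite (L : Inp n) : {s | ok L s}.Finite := by
  have hw := List.finite_length_le (Fin n × Bool) (bnd L)
  refine ((list_finite _ (hw.prod hw) (bnd L)).prod (Set.Finite.pi' (fun i : Fin n => hw))).subset ?_
  rintro ⟨T, h⟩ ⟨h1, h2, h3⟩
  exact ⟨⟨h1, fun p hp => ⟨(h2 p hp).1, (h2 p hp).2⟩⟩, fun i => h3 i⟩

/-- the moves -/
def nxt (M : List (Fin n → List (Fin n × Bool))) (X : List (Fin n × (Fin n × Bool))) (s : Sta n) :
    List (Sta n) :=
  M.map (fun m => (s.1.map (fun p => (FreeGroup.reduce (sub m p.1), p.2)), s.2)) ++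
  X.map (fun x => (s.1, fun i => if i = x.1 then x.2 :: s.2 i else s.2 i))

theorem nxt_primrec (M : List (Fin n → List (Fin n × Bool))) (X : List (Fin n × (Fin n × Bool))) :
    Primrec (nxt M X) := by
  refine list_append.comp (list_map (const M) (Primrec₂.mk (pair ?_ (snd.comp fst))))
    (list_map (const X) (Primrec₂.mk (pair (fst.comp fst) ?_)))
  · refine list_map (fst.comp fst) (Primrec₂.mk (pair ?_ (snd.comp snd)))
    exact reduce_primrec.comp (sub_primrec.comp (snd.comp fst) (fst.comp snd))
  · refine fin_curry.2 (Primrec₂.mk (Primrec.ite ?_ ?_ ?_))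
    · exact Primrec.eq.comp snd (fst.comp (snd.comp fst))
    · exact list_cons.comp (snd.comp (snd.comp fst)) (app_primrec (snd.comp (fst.comp fst)) snd)
    · exact app_primrec (snd.comp (fst.comp fst)) snd

/-- length of the image of a word -/
def len (h : Fin n → List (Fin n × Bool)) (w : List (Fin n × Bool)) : ℕ :=
  (FreeGroup.reduce (sub h w)).length

theorem len_primrec : Primrec₂ (len : (Fin n → List (Fin n × Bool)) → _ → _) :=
  Primrec₂.mk (list_length.comp (reduce_primrec.comp (sub_primrec.comp fst snd)))

abbrev Tri (n : ℕ) := (Fin n × Bool) × (Fin n × Bool) × (Fin n × Bool)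

def badT (h : Fin n → List (Fin n × Bool)) (t : Tri n) : Prop :=
  (t.1.1, !t.1.2) = t.2.1 ∨ (t.2.1.1, !t.2.1.2) = t.2.2 ∨
    h t.1.1 = [] ∨ h t.2.1.1 = [] ∨ h t.2.2.1 = []

def good (h : Fin n → List (Fin n × Bool)) (t : Tri n) : Prop :=
  badT h t ∨ len h [t.1] + len h [t.2.2] < len h [t.1, t.2.1] + len h [t.2.1, t.2.2]

theorem good_primrec : PrimrecRel (good : (Fin n → List (Fin n × Bool)) → Tri n → Prop) := by
  have a1 : Primrec (fun q : (Fin n → List (Fin n × Bool)) × Tri n => q.2.1) := fst.comp snd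
  have a2 : Primrec (fun q : (Fin n → List (Fin n × Bool)) × Tri n => q.2.2.1) :=
    fst.comp (snd.comp snd)
  have a3 : Primrec (fun q : (Fin n → List (Fin n × Bool)) × Tri n => q.2.2.2) :=
    snd.comp (snd.comp snd)
  have hb : PrimrecRel (badT : (Fin n → List (Fin n × Bool)) → Tri n → Prop) := by
    refine PrimrecPred.or ?_ (PrimrecPred.or ?_ (PrimrecPred.or ?_ (PrimrecPred.or ?_ ?_)))
    · exact Primrec.eq.comp (pair (fst.comp a1) (Primrec.not.comp (snd.comp a1))) a2
    · exact Primrec.eq.comp (pair (fst.comp a2) (Primrec.not.comp (snd.comp a2))) a3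
    · exact Primrec.eq.comp (app_primrec fst (fst.comp a1)) (const [])
    · exact Primrec.eq.comp (app_primrec fst (fst.comp a2)) (const [])
    · exact Primrec.eq.comp (app_primrec fst (fst.comp a3)) (const [])
  refine PrimrecPred.or hb (nat_lt.comp (nat_add.comp ?_ ?_) (nat_add.comp ?_ ?_))
  · exact len_primrec.comp fst (list_cons.comp a1 (const []))
  · exact len_primrec.comp fst (list_cons.comp a3 (const []))
  · exact len_primrec.comp fst (list_cons.comp a1 (list_cons.comp a2 (const [])))
  · exact len_primrec.comp fst (list_cons.comp a2 (list_cons.comp a3 (const [])))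

/-- the goal -/
def goal (s : Sta n) : Prop :=
  (∀ p ∈ s.1, (∀ l ∈ FreeGroup.reduce p.1, s.2 l.1 ≠ []) ∧
    FreeGroup.reduce (sub s.2 p.1) = FreeGroup.reduce p.2) ∧ ∀ t : Tri n, good s.2 t

theorem goal_primrec : PrimrecPred (goal : Sta n → Prop) := by
  have h1 : PrimrecRel (fun (l : Fin n × Bool) (h : Fin n → List (Fin n × Bool)) => h l.1 ≠ []) :=
    PrimrecPred.not (Primrec.eq.comp (app_primrec snd (fst.comp fst)) (const []))
  have h2 : PrimrecRel (fun (p : List (Fin n × Bool) × List (Fin n × Bool))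
      (h : Fin n → List (Fin n × Bool)) => (∀ l ∈ FreeGroup.reduce p.1, h l.1 ≠ []) ∧
    FreeGroup.reduce (sub h p.1) = FreeGroup.reduce p.2) := by
    refine PrimrecPred.and ?_ ?_
    · exact (PrimrecRel.forall_mem_list h1).comp (reduce_primrec.comp (fst.comp fst)) snd
    · exact Primrec.eq.comp (reduce_primrec.comp (sub_primrec.comp snd (fst.comp fst)))
        (reduce_primrec.comp (snd.comp fst))
  have h3 : PrimrecRel (fun (t : Tri n) (h : Fin n → List (Fin n × Bool)) => good h t) :=
    good_primrec.comp snd fst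
  refine PrimrecPred.and ((PrimrecRel.forall_mem_list h2).comp fst snd) ?_
  refine ((PrimrecRel.forall_mem_list h3).comp
    (const (Finset.univ : Finset (Tri n)).toList) snd).of_eq fun s => ?_
  simp

theorem small_finite (n : ℕ) : {m : Fin n → List (Fin n × Bool) | ∀ i, (m i).length ≤ 3}.Finite :=
  Set.Finite.pi' (fun i : Fin n => List.finite_length_le (Fin n × Bool) 3)

end comp
end MMP

set_option linter.unusedSectionVars false
set_option linter.unusedVariables false
namespace MMP
open FreeGroup hiding map_mul map_inv map_one
section final
variable {n : ℕ}

theorem mk_sub (h : Fin n → List (Fin n × Bool)) (w : List (Fin n × Bool)) :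
    mk (sub h w) = lift (fun i => mk (h i)) (mk w) := by
  induction w with
  | nil => rfl
  | cons a w ih =>
    have : sub h (a :: w) = (if a.2 = true then h a.1 else FreeGroup.invRev (h a.1)) ++ sub h w := rfl
    rw [this, mk_append, mk_cons, _root_.map_mul, ih]
    congr 1
    obtain ⟨i, e⟩ := a
    cases e
    · rw [lt_false, _root_.map_inv]; simp [inv_mk]
    · rw [lt_true]; simp

theorem agree (z z' : FreeGroup (Fin n) →* FreeGroup (Fin n)) (W : List (Fin n × Bool))
    (h : ∀ l ∈ W, z (of l.1) = z' (of l.1)) : z (mk W) = z' (mk W) := by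
  induction W with
  | nil => have : (mk ([] : List (Fin n × Bool))) = 1 := rfl
           rw [this, _root_.map_one, _root_.map_one]
  | cons a W ih =>
    rw [mk_cons, _root_.map_mul, _root_.map_mul, ih (fun l hl => h l (by simp [hl]))]
    congr 1
    have := h a (by simp)
    obtain ⟨i, e⟩ := a
    cases e
    · rw [lt_false, _root_.map_inv, _root_.map_inv, this]
    · rw [lt_true]; exact this

theorem len_eq (h : Fin n → List (Fin n × Bool)) (w : List (Fin n × Bool)) :
    len h w = (lift (fun i => mk (h i)) (mk w)).norm := by
  rw [← mk_sub]; rfl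

theorem good_iff (h : Fin n → List (Fin n × Bool)) :
    (∀ t : Tri n, good h t) ↔ N2 (lift (fun i => mk (h i))) {i | h i ≠ []} := by
  have key : ∀ a b c : Fin n × Bool,
      (len h [a] + len h [c] < len h [a, b] + len h [b, c] ↔
      cc (lift (fun i => mk (h i)) (lt a)) (lift (fun i => mk (h i)) (lt b)) +
      cc (lift (fun i => mk (h i)) (lt b)) (lift (fun i => mk (h i)) (lt c)) <
        (lift (fun i => mk (h i)) (lt b)).norm) := by
    intro a b c
    have h1 := cc_norm (lift (fun i => mk (h i)) (lt a)) (lift (fun i => mk (h i)) (lt b))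
    have h2 := cc_norm (lift (fun i => mk (h i)) (lt b)) (lift (fun i => mk (h i)) (lt c))
    have e : ∀ x y : Fin n × Bool, mk [x, y] = lt x * lt y := fun x y => mk_cons x [y]
    rw [len_eq, len_eq, len_eq, len_eq, e, e, _root_.map_mul, _root_.map_mul]
    change (lift (fun i => mk (h i)) (lt a)).norm + (lift (fun i => mk (h i)) (lt c)).norm < _ ↔ _
    omega
  constructor
  · intro hg a b c ha hb hc hab hbc
    rcases hg (a, b, c) with h1 | h1
    · exfalso
      rcases h1 with h1 | h1 | h1 | h1 | h1
      · apply hab; simp only at h1; rw [← h1]; simp [bar]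
      · apply hbc; simp only at h1; rw [← h1]; simp [bar]
      · exact ha h1
      · exact hb h1
      · exact hc h1
    · exact (key a b c).1 h1
  · rintro hN ⟨a, b, c⟩
    by_cases hb : badT h (a, b, c)
    · exact Or.inl hb
    · right
      unfold badT at hb
      push Not at hb
      obtain ⟨h1, h2, h3, h4, h5⟩ := hb
      refine (key a b c).2 (hN a b c h3 h4 h5 ?_ ?_)
      · rintro rfl; apply h1; simp [bar]
      · rintro rfl; apply h2; simp [bar]

/-- the set of substitutions given by small automorphisms -/
def MS (n : ℕ) : Set (Fin n → List (Fin n × Bool)) :=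
  {m | (∀ i, (m i).length ≤ 3) ∧
    ∃ σ : FreeGroup (Fin n) ≃* FreeGroup (Fin n), ∀ i, σ (of i) = mk (m i)}

theorem MS_finite (n : ℕ) : (MS n).Finite := (small_finite n).subset fun m hm => hm.1

noncomputable def ML (n : ℕ) : List (Fin n → List (Fin n × Bool)) := (MS_finite n).toFinset.toList

noncomputable def XL (n : ℕ) : List (Fin n × (Fin n × Bool)) := Finset.univ.toList

theorem mem_ML (m : Fin n → List (Fin n × Bool)) : m ∈ ML n ↔ m ∈ MS n := by
  simp [ML]

abbrev St1 (L : Inp n) : Sta n → Sta n → Prop := fun s t => t ∈ nxt (ML n) (XL n) s ∧ ok L t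

theorem hom_eq (m : Fin n → List (Fin n × Bool)) (σ : FreeGroup (Fin n) ≃* FreeGroup (Fin n))
    (h : ∀ i, σ (of i) = mk (m i)) (w : List (Fin n × Bool)) : mk (sub m w) = σ (mk w) := by
  rw [mk_sub]
  have : (lift fun i => mk (m i)) = σ.toMonoidHom := by
    ext i; simp [h]
  rw [this]; rfl

theorem backward (hn : 2 ≤ n) (L : Inp n) (s : Sta n)
    (hs : Relation.ReflTransGen (St1 L) (L, fun _ => []) s) (hg : goal s) :
    ∃ f : FreeGroup (Fin n) →* FreeGroup (Fin n), Function.Injective f ∧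
      ∀ p ∈ L, f (FreeGroup.mk p.1) = FreeGroup.mk p.2 := by
  have h1 : ∃ σ : FreeGroup (Fin n) ≃* FreeGroup (Fin n), ∀ p ∈ L, ∃ q ∈ s.1,
      mk q.1 = σ (mk p.1) ∧ q.2 = p.2 := by
    clear hg
    induction hs with
    | refl => exact ⟨MulEquiv.refl _, fun p hp => ⟨p, hp, rfl, rfl⟩⟩
    | @tail s t _ hst ih =>
      obtain ⟨σ, hσ⟩ := ih
      have hst := hst.1
      unfold nxt at hst
      rw [List.mem_append, List.mem_map, List.mem_map] at hst
      rcases hst with ⟨m, hm, rfl⟩ | ⟨x, hx, rfl⟩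
      · rw [mem_ML] at hm
        obtain ⟨_, τ, hτ⟩ := hm
        refine ⟨σ.trans τ, fun p hp => ?_⟩
        obtain ⟨q, hq, e1, e2⟩ := hσ p hp
        refine ⟨_, List.mem_map.2 ⟨q, hq, rfl⟩, ?_, e2⟩
        simp only [MulEquiv.trans_apply, ← e1]
        rw [← hom_eq m τ hτ]
        exact reduce.self
      · exact ⟨σ, hσ⟩
  obtain ⟨σ, hσ⟩ := h1
  obtain ⟨T, h⟩ := s
  obtain ⟨g1, g2⟩ := hg
  simp only at g1 g2 hσ
  rw [good_iff] at g2
  have : Nontrivial (Fin n) := Fin.nontrivial_iff_two_le.2 hn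
  obtain ⟨z', hz1, hz2⟩ := ext_all this _ _ (fun g => inj_of_N2 g2 g)
  refine ⟨z'.comp σ.toMonoidHom, hz2.comp σ.injective, fun p hp => ?_⟩
  obtain ⟨q, hq, e1, e2⟩ := hσ p hp
  obtain ⟨k1, k2⟩ := g1 q hq
  change z' (σ (mk p.1)) = _
  rw [← e1, ← e2, ← reduce.self (L := q.1), agree z' _ _ (fun l hl => hz1 _ (k1 l hl)), reduce.self,
    ← mk_sub, ← reduce.self, k2, reduce.self]

theorem bnd_le (L : Inp n) : ∀ p ∈ L, p.1.length ≤ bnd L ∧ p.2.length ≤ bnd L := by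
  induction L with
  | nil => simp
  | cons a L ih =>
    have e : bnd (a :: L) = a.1.length + a.2.length + 1 + bnd L := rfl
    intro p hp
    rcases List.mem_cons.1 hp with rfl | hp
    · omega
    · have := ih p hp; omega

theorem bnd_len (L : Inp n) : L.length ≤ bnd L := by
  induction L with
  | nil => simp
  | cons a L ih =>
    have e : bnd (a :: L) = a.1.length + a.2.length + 1 + bnd L := rfl
    rw [List.length_cons]; omega

theorem bnd_size (L : Inp n) (g : List (Fin n × Bool) × List (Fin n × Bool) → FreeGroup (Fin n))
    (h : ∀ p ∈ L, (g p).norm ≤ p.1.length + p.2.length) : size (L.map g) ≤ bnd L := by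
  induction L with
  | nil => simp [size]
  | cons a L ih =>
    have e : bnd (a :: L) = a.1.length + a.2.length + 1 + bnd L := rfl
    have e2 : size ((a :: L).map g) = (g a).norm + size (L.map g) := by simp [size]
    have := ih (fun p hp => h p (by simp [hp]))
    have := h a (by simp)
    omega

theorem norm_le_size (U : List (FreeGroup (Fin n))) (g) (hg : g ∈ U) : g.norm ≤ size U :=
  List.single_le_sum (by simp) _ (List.mem_map.2 ⟨g, hg, rfl⟩)

theorem path1 (L : Inp n) (N : ℕ) (hN : N ≤ bnd L) (b : List (FreeGroup (Fin n)))
    (hb : Relation.ReflTransGen (Stp N) (L.map fun p => mk p.1) b) :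
    ∃ T : Inp n, Relation.ReflTransGen (St1 L) (L, fun _ => []) (T, fun _ => []) ∧
      T.map (fun p => mk p.1) = b ∧ T.map Prod.snd = L.map Prod.snd ∧ ok L (T, fun _ => []) := by
  induction hb with
  | refl => exact ⟨L, .refl, rfl, rfl, bnd_len L, bnd_le L, by simp⟩
  | @tail b c _ hst ih =>
    obtain ⟨T, h1, h2, h3, h4⟩ := ih
    obtain ⟨s1, s2, σ, hσ, rfl⟩ := hst
    have hm : (fun i => (σ (of i)).toWord) ∈ MS n :=
      ⟨fun i => (hσ i).1, σ, fun i => by rw [mk_toWord]⟩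
    set m : Fin n → List (Fin n × Bool) := fun i => (σ (of i)).toWord with hmd
    have hmk : ∀ w, mk (FreeGroup.reduce (sub m w)) = σ (mk w) := by
      intro w
      rw [reduce.self, hom_eq m σ (fun i => by rw [hmd, mk_toWord])]
    set T' : Inp n := T.map (fun p => (FreeGroup.reduce (sub m p.1), p.2)) with hT'
    have e1 : T'.map (fun p => mk p.1) = b.map σ := by
      rw [hT', ← h2]; simp only [List.map_map]
      apply List.map_congr_left
      intro p _
      exact hmk p.1
    have e2 : T'.map Prod.snd = L.map Prod.snd := by
      rw [hT', ← h3]; simp [List.map_map, Function.comp_def]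
    have e3 : ok L (T', fun _ => []) := by
      refine ⟨?_, ?_, by simp⟩
      · have : T'.length = T.length := by simp [hT']
        simp only [this]; exact h4.1
      · intro q hq
        constructor
        · have h5 := norm_le_size (b.map σ) (mk q.1) (by rw [← e1]; exact List.mem_map.2 ⟨q, hq, rfl⟩)
          have : q.1.length = (mk q.1).norm := by
            obtain ⟨p, hp, rfl⟩ := List.mem_map.1 hq
            simp only
            rw [FreeGroup.norm, toWord_mk, reduce.idem]
          omega
        · have : q.2 ∈ L.map Prod.snd := by rw [← e2]; exact List.mem_map.2 ⟨q, hq, rfl⟩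
          obtain ⟨p, hp, e⟩ := List.mem_map.1 this
          rw [← e]; exact (bnd_le L p hp).2
    refine ⟨T', h1.tail ⟨?_, e3⟩, e1, e2, e3⟩
    unfold nxt
    exact List.mem_append_left _ (List.mem_map.2 ⟨m, (mem_ML m).2 hm, rfl⟩)

theorem path2 (L T : Inp n) (hT : ok L (T, fun _ => [])) (k : ℕ) :
    ∀ h : Fin n → List (Fin n × Bool), (∑ i, (h i).length = k) → (∀ i, (h i).length ≤ bnd L) →
    Relation.ReflTransGen (St1 L) (T, fun _ => []) (T, h) := by
  induction k with
  | zero =>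
    intro h h0 _
    have : h = fun _ => [] := by
      funext i
      simpa using (Finset.sum_eq_zero_iff.1 h0) i (Finset.mem_univ i)
    rw [this]
  | succ k ih =>
    intro h hk hb
    have : ∃ i, h i ≠ [] := by
      by_contra hcon
      push Not at hcon
      simp [hcon] at hk
    obtain ⟨i, hi⟩ := this
    obtain ⟨l, t, hlt⟩ := List.exists_cons_of_ne_nil hi
    have hs : ∑ j, (h j).length = ∑ j, (Function.update h i t j).length + 1 := by
      have := Finset.add_sum_erase Finset.univ (fun j => (h j).length) (Finset.mem_univ i)
      have h2 := Finset.add_sum_erase Finset.univ (fun j => (Function.update h i t j).length)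
        (Finset.mem_univ i)
      have h3 : ∑ x ∈ Finset.univ.erase i, (Function.update h i t x).length =
          ∑ x ∈ Finset.univ.erase i, (h x).length := by
        apply Finset.sum_congr rfl
        intro j hj
        rw [Function.update_of_ne (Finset.ne_of_mem_erase hj)]
      simp only [Function.update_self, hlt, List.length_cons] at this h2
      omega
    refine (ih (Function.update h i t) (by omega) ?_).tail ⟨?_, hT.1, hT.2.1, hb⟩
    · intro j
      by_cases hj : j = i
      · subst hj; have := hb j; rw [hlt] at this; simp at this ⊢; omega
      · rw [Function.update_of_ne hj]; exact hb j
    · unfold nxt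
      refine List.mem_append_right _ (List.mem_map.2 ⟨(i, l), by simp [XL], ?_⟩)
      simp only [Prod.mk.injEq, true_and]
      funext j
      by_cases hj : j = i
      · subst hj; simp [hlt]
      · simp [hj]

theorem forward (L : Inp n) (f : FreeGroup (Fin n) →* FreeGroup (Fin n))
    (hf : Function.Injective f) (hL : ∀ p ∈ L, f (FreeGroup.mk p.1) = FreeGroup.mk p.2) :
    ∃ s, Relation.ReflTransGen (St1 L) (L, fun _ => []) s ∧ goal s := by
  classical
  obtain ⟨β, hN, hβ⟩ := exists_nred f hf
  set z := f.comp β.toMonoidHom with hz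
  have hzi : Function.Injective z := hf.comp β.injective
  have hzb : ∀ g, z (β.symm g) = f g := by intro g; simp [hz]
  have hnv : ∀ p : List (Fin n × Bool) × List (Fin n × Bool), (mk p.2).norm ≤ p.2.length :=
    fun p => norm_mk_le
  have hw := W3 (L.map fun p => mk p.1) β.symm
  have hb1 : size (L.map fun p => mk p.1) ≤ bnd L :=
    bnd_size L _ fun p _ => le_trans norm_mk_le (by omega)
  have hb2 : size ((L.map fun p => mk p.1).map β.symm) ≤ bnd L := by
    rw [List.map_map]
    apply bnd_size
    intro p hp
    have h1 := glob3 hN (β.symm (mk p.1)).toWord isReduced_toWord (by simp)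
    rw [mk_toWord, hzb, hL p hp] at h1
    have := hnv p
    change (β.symm (mk p.1)).toWord.length ≤ _
    omega
  obtain ⟨T, h1, h2, h3, h4⟩ := path1 L _ (max_le hb1 hb2) _ hw
  let O : Set (Fin n) := {i | ∃ p ∈ L, ∃ l ∈ (β.symm (mk p.1)).toWord, l.1 = i}
  let h : Fin n → List (Fin n × Bool) := fun i => if i ∈ O then (z (of i)).toWord else []
  have hO : ∀ i, h i ≠ [] ↔ i ∈ O := by
    intro i
    by_cases hi : i ∈ O
    · simp only [h, hi, if_true, iff_true]
      intro h0
      have := hzi ((toWord_eq_nil_iff.1 h0).trans (_root_.map_one z).symm)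
      exact of_ne_one i this
    · simp [h, hi]
  have hl : ∀ i ∈ O, lift (fun i => mk (h i)) (of i) = z (of i) := by
    intro i hi
    simp [h, hi, mk_toWord]
  refine ⟨(T, h), h1.trans (path2 L T h4 _ h rfl ?_), ?_, ?_⟩
  · intro i
    by_cases hi : i ∈ O
    · obtain ⟨p, hp, l, hlw, rfl⟩ := id hi
      simp only [h, hi, if_true]
      have k1 := hβ _ isReduced_toWord l hlw
      rw [mk_toWord, MulEquiv.apply_symm_apply, hL p hp] at k1
      have k2 : (z (of l.1)).toWord.length = (f (β (lt l))).norm := by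
        change (z (of l.1)).norm = (z (lt l)).norm
        obtain ⟨i, e⟩ := l
        cases e
        · rw [lt_false, _root_.map_inv, norm_inv_eq]
        · rw [lt_true]
      have := hnv p
      have := (bnd_le L p hp).2
      omega
    · simp [h, hi]
  · -- words
    intro q hq
    have hlen : T.length = L.length := by simpa using congrArg List.length h3
    obtain ⟨k, hk, rfl⟩ := List.getElem_of_mem hq
    have hk' : k < L.length := hlen ▸ hk
    have e1 : mk (T[k]).1 = β.symm (mk (L[k]).1) := by
      have := congrArg (fun l => l[k]?) h2
      simpa [hk, hk'] using this
    have e2 : (T[k]).2 = (L[k]).2 := by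
      have := congrArg (fun l => l[k]?) h3
      simpa [hk, hk'] using this
    have hLk : L[k] ∈ L := List.getElem_mem hk'
    have hin : ∀ l ∈ FreeGroup.reduce (T[k]).1, l.1 ∈ O := by
      intro l hl
      rw [← toWord_mk, e1] at hl
      exact ⟨_, hLk, l, hl, rfl⟩
    refine ⟨fun l hl => (hO _).2 (hin l hl), ?_⟩
    simp only
    rw [← toWord_mk, ← toWord_mk, mk_sub, ← reduce.self (L := (T[k]).1),
      agree _ z _ (fun l hl' => hl _ (hin l hl')), reduce.self, e1, hzb, hL _ hLk, e2]
  · rw [good_iff]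
    have hlt : ∀ a : Fin n × Bool, a.1 ∈ {i | h i ≠ []} →
        lift (fun i => mk (h i)) (lt a) = z (lt a) := by
      intro a ha
      exact agree _ z [a] (fun l hl' => by
        have : l = a := by simpa using hl'
        subst this; exact hl _ ((hO _).1 ha))
    intro a b c ha hb hc hab hbc
    rw [hlt a ha, hlt b hb, hlt c hc]
    exact hN a b c trivial trivial trivial hab hbc

end final
end MMP

theorem multiple_monomorphism_problem_decidable (n : ℕ) (hn : 2 ≤ n) :
    ∃ d : List (List (Fin n × Bool) × List (Fin n × Bool)) → Bool,
      Computable d ∧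
      ∀ L : List (List (Fin n × Bool) × List (Fin n × Bool)),
        d L = true ↔
          ∃ f : FreeGroup (Fin n) →* FreeGroup (Fin n),
            Function.Injective f ∧
            ∀ p ∈ L, f (FreeGroup.mk p.1) = FreeGroup.mk p.2 := by
  obtain ⟨d, hd, h⟩ := MMP.search (fun L : MMP.Inp n => ((L, fun _ => []) : MMP.Sta n))
    (MMP.nxt (MMP.ML n) (MMP.XL n)) MMP.ok MMP.goal (Primrec.pair Primrec.id (Primrec.const _))
    (MMP.nxt_primrec _ _) MMP.ok_primrec MMP.goal_primrec MMP.ok_finite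
  refine ⟨d, hd, fun L => (h L).trans ⟨?_, ?_⟩⟩
  · rintro ⟨s, hs, hg⟩
    exact MMP.backward hn L s hs hg
  · rintro ⟨f, hf, hL⟩
    exact MMP.forward L f hf hL
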